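/- arXiv:1412.2035 — 2 statements merged into one kernel-verified Lean document; each statement's English description precedes it below -/
import Mathlib

section
/- For every integer d ≥ 2 there exists a constant C_d > 0 such that A_{d,1}(n) · n^{((d-1)^2 - 1)/2} / (d-1)^{2n} converges to C_d as n → ∞; that is, the number of permutations of {1,...,n} avoiding an increasing subsequence of length d satisfies A_{d,1}(n) ~ C_d · (d-1)^{2n} · n^{-((d-1)^2-1)/2}. -/
open Filter

/-- A word `w : Fin N → Fin n` is `12...d`-avoiding if there is no strictly
increasing sequence of `d` positions on which the values are strictly increasing. -/
def Avoids (d : ℕ) {N n : ℕ} (w : Fin N → Fin n) : Prop :=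
  ¬ ∃ s : Fin d → Fin N, StrictMono s ∧ StrictMono (w ∘ s)

/-- `A d r n` is the number of `12...d`-avoiding words on the alphabet `{1,...,n}`
in which each letter occurs exactly `r` times; for `r = 1` these are the
`12...d`-avoiding permutations of `{1,...,n}`. -/
noncomputable def A (d r n : ℕ) : ℕ :=
  Nat.card {w : Fin (n * r) → Fin n //
    (∀ v : Fin n, Nat.card {i : Fin (n * r) // w i = v} = r) ∧ Avoids d w}

/-- A word over `ℕ`, most recent letter first, is a Yamanouchi word if the multiplicities of the
letters in each of its suffixes are weakly decreasing. Reading the letter `i` as: add a box to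
column `i`, these words encode standard Young tableaux by their column indices. -/
def Yamanouchi : List ℕ → Prop
  | [] => True
  | a :: T => (∀ i, (a :: T).count (i + 1) ≤ (a :: T).count i) ∧ Yamanouchi T

theorem Yamanouchi.antitone_count {T : List ℕ} (h : Yamanouchi T) :
    Antitone fun i => T.count i := by
  refine antitone_nat_of_succ_le fun i => ?_
  cases T with
  | nil => simp
  | cons a T => exact h.1 i

/-- `RowInsert T v T' b`: Schensted insertion of an entry of rank `v` turns the tableau `T`
into `T'`, whose shape has one more box, in column `b`. -/
inductive RowInsert : List ℕ → ℕ → List ℕ → ℕ → Prop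
  | new {T : List ℕ} {b : ℕ} (h0 : T.count b = 0) (h1 : ∀ j < b, T.count j ≠ 0) :
      RowInsert T T.length (b :: T) b
  | swap {T T' : List ℕ} {v a b : ℕ} (h : RowInsert T v T' b) (hab : a ≠ b) :
      RowInsert (a :: T) v (a :: T') b
  | bump {T T' : List ℕ} {v a b : ℕ} (h : RowInsert T v T' b)
      (h0 : (b :: T).count a = (b :: T).count b)
      (h1 : ∀ j < a, (b :: T).count j ≠ (b :: T).count b) :
      RowInsert (b :: T) v (a :: T') a

namespace RowInsert

variable {T T' : List ℕ} {v b : ℕ}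

theorem le_length (h : RowInsert T v T' b) : v ≤ T.length := by
  induction h <;> simp <;> omega

theorem perm (h : RowInsert T v T' b) : T'.Perm (b :: T) := by
  induction h with
  | new => exact List.Perm.refl _
  | swap _ _ ih => exact (ih.cons _).trans (List.Perm.swap _ _ _)
  | bump _ _ _ ih => exact ih.cons _

theorem count_eq (h : RowInsert T v T' b) (i : ℕ) : T'.count i = (b :: T).count i :=
  h.perm.count_eq i

theorem yamanouchi (h : RowInsert T v T' b) (hT : Yamanouchi T) : Yamanouchi T' := by
  induction h with
  | @new T b h0 h1 =>
    refine ⟨fun i => ?_, hT⟩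
    have := hT.antitone_count (Nat.le_succ i)
    have h1 := h1 i
    simp only [List.count_cons] at *
    grind
  | @swap T T' v a b h hab ih =>
    have hT' := ih hT.2
    refine ⟨fun i => ?_, hT'⟩
    have e1 := h.count_eq i
    have e2 := h.count_eq (i + 1)
    have e3 := hT'.antitone_count (Nat.le_succ i)
    have e4 := hT.1 i
    simp only [List.count_cons] at *
    grind
  | @bump T T' v a b h h0 h1 ih =>
    have hT' := ih hT.2
    refine ⟨fun i => ?_, hT'⟩
    have e1 := h.count_eq i
    have e2 := h.count_eq (i + 1)
    have e4 := hT.1 i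
    have h1 := h1 i
    rw [List.count_cons, List.count_cons, e1, e2]
    by_cases hi : a = i + 1
    · subst hi
      have := h1 (Nat.lt_succ_self i)
      simp
      grind
    · simp [hi]; omega

theorem exists_of_le (hT : Yamanouchi T) (hv : v ≤ T.length) : ∃ T' b, RowInsert T v T' b := by
  have first : ∀ (T : List ℕ) (c : ℕ), (∃ j, T.count j = c) →
      ∃ j, T.count j = c ∧ ∀ i < j, T.count i ≠ c := fun T c h =>
    ⟨Nat.find h, Nat.find_spec h, fun i hi => Nat.find_min h hi⟩
  have new : ∀ T : List ℕ, ∃ T' b, RowInsert T T.length T' b := fun T => by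
    obtain ⟨j, hj⟩ := Infinite.exists_notMem_finset T.toFinset
    obtain ⟨b, h0, h1⟩ := first T 0 ⟨j, List.count_eq_zero.2 (by simpa using hj)⟩
    exact ⟨_, _, .new h0 h1⟩
  induction T with
  | nil =>
    obtain rfl : v = 0 := by simpa using hv
    exact new []
  | cons a T ih =>
    rcases hv.eq_or_lt with rfl | hv
    · exact new _
    · obtain ⟨T', b, h⟩ := ih hT.2 (by simp at hv; omega)
      by_cases hab : a = b
      · subst hab
        obtain ⟨a', h0, h1⟩ := first (a :: T) _ ⟨a, rfl⟩
        exact ⟨_, _, .bump h h0 h1⟩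
      · exact ⟨_, _, .swap h hab⟩

theorem first_unique {p : ℕ → Prop} {a b : ℕ} (ha : p a) (ha' : ∀ j < a, ¬ p j)
    (hb : p b) (hb' : ∀ j < b, ¬ p j) : a = b :=
  le_antisymm (not_lt.1 fun h => ha' _ h hb) (not_lt.1 fun h => hb' _ h ha)

theorem unique (h : RowInsert T v T' b) {T₁ : List ℕ} {b₁ : ℕ} (h₁ : RowInsert T v T₁ b₁) :
    T' = T₁ ∧ b = b₁ := by
  induction h generalizing T₁ b₁ with
  | @new T b h0 h1 =>
    generalize hv : T.length = v at h₁
    cases h₁ with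
    | new h0' h1' =>
      obtain rfl := first_unique (p := fun j => T.count j = 0) h0 h1 h0' h1'
      exact ⟨rfl, rfl⟩
    | swap h => have := h.le_length; simp at hv; omega
    | bump h => have := h.le_length; simp at hv; omega
  | @swap T T' v a b h hab ih =>
    cases h₁ with
    | new => have := h.le_length; simp at this
    | swap h' => obtain ⟨rfl, rfl⟩ := ih h'; exact ⟨rfl, rfl⟩
    | bump h' => exact absurd (ih h').2.symm hab
  | @bump T T' v a b h h0 h1 ih =>
    cases h₁ with
    | new => have := h.le_length; simp at this
    | swap h' hab => exact absurd (ih h').2 hab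
    | bump h' h0' h1' =>
      obtain ⟨rfl, -⟩ := ih h'
      obtain rfl := first_unique (p := fun j => (b :: T).count j = (b :: T).count b) h0 h1 h0' h1'
      exact ⟨rfl, rfl⟩

theorem unique_left (h : RowInsert T v T' b) (hT : Yamanouchi T) {T₁ : List ℕ} {v₁ : ℕ}
    (h₁ : RowInsert T₁ v₁ T' b) (hT₁ : Yamanouchi T₁) : T = T₁ ∧ v = v₁ := by
  induction h generalizing T₁ v₁ with
  | @new T b h0 h1 =>
    cases h₁ with
    | new => exact ⟨rfl, rfl⟩
    | swap h hab => exact absurd rfl hab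
    | @bump T₀ _ v a b' h h0' h1' =>
      have := h.count_eq b
      simp at h0'
      omega
  | @swap T T' v a b h hab ih =>
    cases h₁ with
    | new => exact absurd rfl hab
    | swap h' =>
      obtain ⟨rfl, rfl⟩ := ih hT.2 h' hT₁.2
      exact ⟨rfl, rfl⟩
    | bump => exact absurd rfl hab
  | @bump T T' v a b h h0 h1 ih =>
    cases h₁ with
    | new h0' =>
      have := h.count_eq a
      simp at h0
      omega
    | swap h' hab => exact absurd rfl hab
    | @bump T₀ _ v₀ _ b' h' h0' h1' =>
      have e : ∀ i, (b :: T).count i = (b' :: T₀).count i := fun i =>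
        (h.count_eq i).symm.trans (h'.count_eq i)
      have hb : b = b' := by
        have e1 := e b
        have e2 := e b'
        have e3 := e a
        rcases lt_trichotomy b b' with hlt | heq | hlt
        · have := hT.2.antitone_count hlt.le
          simp only [List.count_cons] at *
          grind
        · exact heq
        · have := hT₁.2.antitone_count hlt.le
          simp only [List.count_cons] at *
          grind
      subst hb
      obtain ⟨rfl, rfl⟩ := ih hT.2 h' hT₁.2
      exact ⟨rfl, rfl⟩

theorem exists_left (hT' : Yamanouchi T') (hb : T'.count (b + 1) < T'.count b) :
    ∃ T v, Yamanouchi T ∧ RowInsert T v T' b := by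
  induction T' generalizing b with
  | nil => simp at hb
  | cons x T' ih =>
    have anti := hT'.antitone_count
    have anti' := hT'.2.antitone_count
    by_cases hx : x = b
    · subst hx
      by_cases h0 : T'.count x = 0
      · refine ⟨T', _, hT'.2, .new h0 fun j hj => ?_⟩
        have := anti hj.le
        simp only [List.count_cons] at *
        grind
      · obtain ⟨y, hy⟩ := Infinite.exists_notMem_finset T'.toFinset
        have hy : T'.count y = 0 := List.count_eq_zero.2 (by simpa using hy)
        have hex : ∃ j, x < j ∧ T'.count j < T'.count x := by
          refine ⟨y, ?_, by omega⟩
          by_contra hle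
          have := anti' (not_lt.1 hle)
          simp only at this; omega
        obtain ⟨hj1, hj2⟩ := Nat.find_spec hex
        have hmin := fun i (hi : i < Nat.find hex) => Nat.find_min hex hi
        obtain ⟨c, hc⟩ : ∃ c, Nat.find hex = c + 1 := ⟨Nat.find hex - 1, by omega⟩
        rw [hc] at hj1 hj2 hmin
        have hcx : T'.count c = T'.count x := by
          have := hmin c (by omega)
          have := anti' (show x ≤ c by omega)
          simp only at this
          grind
        obtain ⟨T, v, hT, h⟩ := ih hT'.2 (b := c) (by omega)
        refine ⟨c :: T, v, ⟨fun i => ?_, hT⟩, .bump h ?_ fun j hj => ?_⟩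
        · rw [← h.count_eq, ← h.count_eq]; exact anti' (Nat.le_succ i)
        · rw [← h.count_eq, ← h.count_eq, hcx]
        · rw [← h.count_eq, ← h.count_eq, hcx]
          have := anti hj.le
          simp only [List.count_cons] at this
          grind
    · obtain ⟨T, v, hT, h⟩ := ih hT'.2 (b := b) (by simp only [List.count_cons] at hb; grind)
      refine ⟨x :: T, v, ⟨fun i => ?_, hT⟩, .swap h hx⟩
      have e1 := h.count_eq i
      have e2 := h.count_eq (i + 1)
      have := hT'.1 i
      simp only [List.count_cons] at *
      grind

/-- Up to the rank of the inserted entry, insertion does not change the tableau. -/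
theorem drop_eq (h : RowInsert T v T' b) {j : ℕ} (hj : j ≤ v) :
    T'.drop (T.length + 1 - j) = T.drop (T.length - j) := by
  induction h with
  | @new T b h0 h1 => rw [Nat.sub_add_comm hj]; rfl
  | @swap T T' v a b h _ ih | @bump T T' v a b h _ _ ih =>
    have := h.le_length
    rw [List.length_cons, Nat.sub_add_comm (show j ≤ T.length + 1 by omega),
      List.drop_succ_cons, ih hj, Nat.sub_add_comm (show j ≤ T.length by omega),
      List.drop_succ_cons]

/-- The growth of the first row under insertion. -/
theorem mem_drop (h : RowInsert T v T' b) {j : ℕ} (hvj : v ≤ j) (hj : j ≤ T.length) (m : ℕ) :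
    m ∈ T'.drop (T.length - j) ↔
      m ∈ T.drop (T.length - j) ∨ ∀ m' < m, m' ∈ T.drop (T.length - v) := by
  induction h generalizing j with
  | @new T b h0 h1 =>
    obtain rfl : j = T.length := le_antisymm hj hvj
    simp only [Nat.sub_self, List.drop_zero, List.mem_cons]
    have h0 := List.count_eq_zero.1 h0
    have h1 : ∀ i < b, i ∈ T := fun i hi => by_contra fun h => h1 i hi (List.count_eq_zero.2 h)
    constructor
    · rintro (rfl | h)
      · exact .inr h1
      · exact .inl h
    · rintro (h | h)
      · exact .inr h
      · rcases lt_trichotomy m b with hm | hm | hm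
        · exact .inr (h1 m hm)
        · exact .inl hm
        · exact absurd (h b hm) h0
  | @swap T T' v a b h hab ih =>
    have hv := h.le_length
    rw [List.length_cons] at hj ⊢
    rcases hj.eq_or_lt with rfl | hj
    · have := ih hv le_rfl
      simp only [Nat.sub_self, List.drop_zero, List.mem_cons] at this ⊢
      rw [this, Nat.sub_add_comm hv, List.drop_succ_cons, or_assoc]
    · have hj := Nat.le_of_lt_succ hj
      rw [Nat.sub_add_comm hj, Nat.sub_add_comm hv]
      exact ih hvj hj
  | @bump T T' v a b h h0 h1 ih =>
    have hv := h.le_length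
    rw [List.length_cons] at hj ⊢
    rcases hj.eq_or_lt with rfl | hj
    · have ih := ih hv le_rfl
      have ha : a ∈ b :: T := List.count_pos_iff.1 (by rw [h0]; simp)
      rw [Nat.sub_self, List.drop_zero, List.drop_zero, List.mem_cons, h.perm.mem_iff]
      rw [Nat.sub_self, List.drop_zero, List.drop_zero, h.perm.mem_iff] at ih
      rw [Nat.sub_add_comm hv, List.drop_succ_cons]
      grind
    · have hj := Nat.le_of_lt_succ hj
      rw [Nat.sub_add_comm hj, Nat.sub_add_comm hv]
      exact ih hvj hj

end RowInsert

/-- `HasIncreasing f m j`: among the values smaller than `j`, the word `f` has an increasing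
subsequence of length `m`. -/
def HasIncreasing {N n : ℕ} (f : Fin N → Fin n) (m j : ℕ) : Prop :=
  ∃ s : Finset (Fin N), s.card = m ∧ StrictMonoOn f s ∧ ∀ i ∈ s, (f i : ℕ) < j

theorem HasIncreasing.mono {N n : ℕ} {f : Fin N → Fin n} {m m' j : ℕ}
    (h : HasIncreasing f m j) (hm : m' ≤ m) : HasIncreasing f m' j := by
  obtain ⟨s, rfl, h2, h3⟩ := h
  obtain ⟨t, hts, rfl⟩ := Finset.exists_subset_card_eq hm
  exact ⟨t, rfl, h2.mono hts, fun i hi => h3 i (hts hi)⟩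

theorem not_avoids_iff {N n d : ℕ} (f : Fin N → Fin n) :
    ¬ Avoids d f ↔ HasIncreasing f d n := by
  rw [Avoids, not_not]
  constructor
  · rintro ⟨s, hs, hfs⟩
    refine ⟨Finset.univ.map ⟨s, hs.injective⟩, by simp, ?_, fun i _ => (f i).2⟩
    intro a ha b hb hab
    simp only [Finset.coe_map, Function.Embedding.coeFn_mk, Finset.coe_univ, Set.image_univ,
      Set.mem_range] at ha hb
    obtain ⟨i, rfl⟩ := ha
    obtain ⟨j, rfl⟩ := hb
    exact hfs (hs.lt_iff_lt.1 hab)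
  · rintro ⟨s, hs, hfs, -⟩
    refine ⟨s.orderEmbOfFin hs, (s.orderEmbOfFin hs).strictMono, fun i j hij => ?_⟩
    exact hfs (s.orderEmbOfFin_mem hs i) (s.orderEmbOfFin_mem hs j)
      ((s.orderEmbOfFin hs).strictMono hij)

/-- Append the value `v` to a word, shifting the values `≥ v` up by one. -/
def appendValue {n : ℕ} (v : Fin (n + 1)) (f : Fin n → Fin n) : Fin (n + 1) → Fin (n + 1) :=
  Fin.snoc (α := fun _ => Fin (n + 1)) (v.succAbove ∘ f) v

section appendValue

variable {n : ℕ} {v : Fin (n + 1)} {f : Fin n → Fin n}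

@[simp] theorem appendValue_last : appendValue v f (Fin.last n) = v := by
  simp [appendValue]

@[simp] theorem appendValue_castSucc (i : Fin n) :
    appendValue v f i.castSucc = v.succAbove (f i) := by
  simp [appendValue]

theorem succAbove_lt_iff (x : Fin n) {j : ℕ} (hj : j ≤ v) :
    (v.succAbove x : ℕ) < j ↔ (x : ℕ) < j := by
  rcases lt_or_ge x.castSucc v with h | h
  · rw [Fin.succAbove_of_castSucc_lt _ _ h]; simp
  · rw [Fin.succAbove_of_le_castSucc _ _ h]
    simp [Fin.le_def] at h ⊢
    omega

theorem succAbove_lt_succ_iff (x : Fin n) {j : ℕ} (hj : (v : ℕ) ≤ j) :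
    (v.succAbove x : ℕ) < j + 1 ↔ (x : ℕ) < j := by
  rcases lt_or_ge x.castSucc v with h | h
  · rw [Fin.succAbove_of_castSucc_lt _ _ h]
    simp [Fin.lt_def] at h ⊢
    omega
  · rw [Fin.succAbove_of_le_castSucc _ _ h]; simp

/-- Increasing subsequences of an extended word which do not use the appended letter. -/
theorem HasIncreasing.of_appendValue {m j j' : ℕ} {s : Finset (Fin (n + 1))}
    (hs : Fin.last n ∉ s) (hm : s.card = m) (hf : StrictMonoOn (appendValue v f) s)
    (hj : ∀ i ∈ s, (appendValue v f i : ℕ) < j)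
    (hjj : ∀ x : Fin n, (v.succAbove x : ℕ) < j → (x : ℕ) < j') : HasIncreasing f m j' := by
  refine ⟨Finset.univ.filter fun i => i.castSucc ∈ s, ?_, ?_, ?_⟩
  · rw [← hm, ← Finset.card_map Fin.castSuccEmb]
    congr 1
    ext i
    induction i using Fin.lastCases with
    | last => simpa using hs
    | cast i => simp
  · intro a ha b hb hab
    have := hf (a := a.castSucc) (b := b.castSucc) (by simpa using ha) (by simpa using hb)
      (by simpa using hab)
    simpa [Fin.succAbove_lt_succAbove_iff] using this
  · intro i hi
    exact hjj _ (by simpa using hj i.castSucc (by simpa using hi))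

theorem HasIncreasing.appendValue {m j j' : ℕ} (h : HasIncreasing f m j)
    (hjj : ∀ x : Fin n, (x : ℕ) < j → (v.succAbove x : ℕ) < j') :
    HasIncreasing (appendValue v f) m j' := by
  obtain ⟨s, rfl, hf, hs⟩ := h
  refine ⟨s.map Fin.castSuccEmb, by simp, ?_, ?_⟩
  · intro a ha b hb hab
    simp only [Finset.coe_map, Set.mem_image, Finset.mem_coe, Fin.coe_castSuccEmb] at ha hb
    obtain ⟨a, ha, rfl⟩ := ha
    obtain ⟨b, hb, rfl⟩ := hb
    simpa [Fin.succAbove_lt_succAbove_iff] using hf ha hb (by simpa using hab)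
  · simp only [Finset.mem_map, forall_exists_index, and_imp]
    rintro _ i hi rfl
    simpa using hjj _ (hs i hi)

theorem hasIncreasing_appendValue_of_le {m j : ℕ} (hj : j ≤ v) :
    HasIncreasing (appendValue v f) m j ↔ HasIncreasing f m j := by
  constructor
  · rintro ⟨s, hm, hf, hs⟩
    refine .of_appendValue (fun h => ?_) hm hf hs fun x => (succAbove_lt_iff x hj).1
    have := hs _ h
    simp at this; omega
  · exact fun h => h.appendValue fun x => (succAbove_lt_iff x hj).2

theorem hasIncreasing_appendValue_succ {m j : ℕ} (hj : (v : ℕ) ≤ j) :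
    HasIncreasing (appendValue v f) (m + 1) (j + 1) ↔
      HasIncreasing f (m + 1) j ∨ HasIncreasing f m v := by
  constructor
  · rintro ⟨s, hm, hf, hs⟩
    by_cases hl : Fin.last n ∈ s
    · right
      refine .of_appendValue (v := v) (s := s.erase (Fin.last n)) (j := v) (by simp) ?_
        (hf.mono (by simp)) (fun i hi => ?_) fun x => (succAbove_lt_iff x le_rfl).1
      · rw [Finset.card_erase_of_mem hl, hm]; rfl
      · have hi := Finset.mem_erase.1 hi
        have := hf hi.2 hl (lt_of_le_of_ne (Fin.le_last i) hi.1)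
        simpa using this
    · exact .inl (.of_appendValue hl hm hf hs fun x => (succAbove_lt_succ_iff x hj).1)
  · rintro (h | h)
    · exact h.appendValue fun x => (succAbove_lt_succ_iff x hj).2
    · obtain ⟨s, hm, hf, hs⟩ := h.appendValue (v := v) fun x => (succAbove_lt_iff x le_rfl).2
      have hl : Fin.last n ∉ s := fun h => by simpa using hs _ h
      refine ⟨insert (Fin.last n) s, by rw [Finset.card_insert_of_notMem hl, hm], ?_, ?_⟩
      · intro a ha b hb hab
        simp only [Finset.coe_insert, Set.mem_insert_iff, Finset.mem_coe] at ha hb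
        rcases ha with rfl | ha
        · exact absurd hab (not_lt.2 (Fin.le_last b))
        · rcases hb with rfl | hb
          · simpa using hs a ha
          · exact hf ha hb hab
      · intro i hi
        rcases Finset.mem_insert.1 hi with rfl | hi
        · simp; omega
        · have := hs i hi
          omega

end appendValue

/-- Permutations of `{0, ..., n - 1}` as words. -/
abbrev PermWord (n : ℕ) : Type := {f : Fin n → Fin n // Function.Injective f}

/-- A permutation word of length `n + 1` is a permutation word of length `n` together with
its last value. -/
noncomputable def PermWord.appendEquiv (n : ℕ) :
    Fin (n + 1) × PermWord n ≃ PermWord (n + 1) :=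
  Equiv.ofBijective
    (fun p => ⟨appendValue p.1 p.2.1, by
      intro i j
      induction i using Fin.lastCases with
      | last =>
        induction j using Fin.lastCases with
        | last => simp
        | cast j => simp
      | cast i =>
        induction j using Fin.lastCases with
        | last => simp
        | cast j => simpa using fun h => p.2.2 h⟩)
    (by
      constructor
      · rintro ⟨v, f⟩ ⟨v', f'⟩ h
        have h := congrArg Subtype.val h
        simp only at h
        obtain rfl : v = v' := by simpa using congrFun h (Fin.last n)
        have : f = f' := by
          ext i : 2
          simpa using congrFun h i.castSucc
        rw [this]
      · rintro ⟨g, hg⟩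
        have h : ∀ i : Fin n, ∃ y, (g (Fin.last n)).succAbove y = g i.castSucc := fun i =>
          Fin.exists_succAbove_eq fun h => (Fin.castSucc_lt_last i).ne (hg h)
        choose f hf using h
        refine ⟨(g (Fin.last n), ⟨f, fun i j hij => ?_⟩), ?_⟩
        · simpa using hg ((hf i).symm.trans ((congrArg _ hij).trans (hf j)))
        · ext i : 2
          induction i using Fin.lastCases with
          | last => simp
          | cast i => simp [hf])

theorem PermWord.coe_appendEquiv {n : ℕ} (p : Fin (n + 1) × PermWord n) :
    (PermWord.appendEquiv n p : Fin (n + 1) → Fin (n + 1)) = appendValue p.1 p.2.1 := rfl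

/-- Pairs of standard Young tableaux of the same shape. -/
abbrev TableauPair (n : ℕ) : Type :=
  {p : List ℕ × List ℕ // Yamanouchi p.1 ∧ Yamanouchi p.2 ∧ p.1.Perm p.2 ∧ p.1.length = n}

/-- The Robinson-Schensted correspondence, with Schensted's description of the first rows. -/
theorem exists_robinsonSchensted (n : ℕ) :
    ∃ Φ : PermWord n ≃ TableauPair n, ∀ w m j, j ≤ n →
      (HasIncreasing w.1 (m + 1) j ↔ m ∈ (Φ w).1.1.drop (n - j)) := by
  induction n with
  | zero =>
    have h1 : Nonempty (PermWord 0) := ⟨⟨id, Function.injective_id⟩⟩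
    have h2 : Subsingleton (TableauPair 0) := by
      constructor
      rintro ⟨⟨a, b⟩, -, -, h, h'⟩ ⟨⟨a', b'⟩, -, -, k, k'⟩
      obtain rfl := List.length_eq_zero_iff.1 h'
      obtain rfl := List.length_eq_zero_iff.1 k'
      obtain rfl := List.nil_perm.1 h
      obtain rfl := List.nil_perm.1 k
      rfl
    have h3 : Nonempty (TableauPair 0) :=
      ⟨⟨([], []), trivial, trivial, List.Perm.refl _, rfl⟩⟩
    obtain ⟨w⟩ := h1
    obtain ⟨t⟩ := h3
    refine ⟨⟨fun _ => t, fun _ => w, fun _ => Subsingleton.elim _ _,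
      fun _ => Subsingleton.elim _ _⟩, fun w m j _ => ?_⟩
    have := List.length_eq_zero_iff.1 t.2.2.2.2
    simp only [Equiv.coe_fn_mk, this, List.drop_nil, List.not_mem_nil, iff_false]
    rintro ⟨s, hs, -⟩
    simp [Finset.eq_empty_of_isEmpty s] at hs
  | succ n ih =>
    obtain ⟨Φ, hΦ⟩ := ih
    have ex : ∀ p : Fin (n + 1) × PermWord n, ∃ q : List ℕ × ℕ,
        RowInsert (Φ p.2).1.1 p.1 q.1 q.2 := fun p => by
      obtain ⟨T', b, h⟩ := RowInsert.exists_of_le (v := p.1) (Φ p.2).2.1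
        (by rw [(Φ p.2).2.2.2.2]; omega)
      exact ⟨(T', b), h⟩
    choose q hq using ex
    have good : ∀ p : Fin (n + 1) × PermWord n,
        Yamanouchi (q p).1 ∧ Yamanouchi ((q p).2 :: (Φ p.2).1.2) ∧
        (q p).1.Perm ((q p).2 :: (Φ p.2).1.2) ∧ (q p).1.length = n + 1 := fun p => by
      obtain ⟨h1, h2, h3, h4⟩ := (Φ p.2).2
      have hy := (hq p).yamanouchi h1
      have hperm := (hq p).perm.trans (h3.cons _)
      refine ⟨hy, ⟨fun i => ?_, h2⟩, hperm, ?_⟩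
      · rw [← hperm.count_eq, ← hperm.count_eq]
        exact hy.antitone_count (Nat.le_succ i)
      · rw [(hq p).perm.length_eq, List.length_cons, h4]
    let Ψ : Fin (n + 1) × PermWord n → TableauPair (n + 1) := fun p =>
      ⟨((q p).1, (q p).2 :: (Φ p.2).1.2), good p⟩
    have hΨ : Function.Bijective Ψ := by
      constructor
      · rintro p p' h
        have h := congrArg Subtype.val h
        simp only [Ψ, Prod.mk.injEq, List.cons.injEq] at h
        obtain ⟨e1, e2, e3⟩ := h
        have hp := hq p
        rw [e1, e2] at hp
        obtain ⟨e4, e5⟩ := hp.unique_left (Φ p.2).2.1 (hq p') (Φ p'.2).2.1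
        exact Prod.ext (Fin.ext e5) (Φ.injective (Subtype.ext (Prod.ext e4 e3)))
      · rintro ⟨⟨P, Q⟩, hP, hQ, hPQ, hn⟩
        simp only at hP hQ hPQ hn
        cases Q with
        | nil => rw [List.perm_nil.1 hPQ] at hn; simp at hn
        | cons b Q =>
          have hb : P.count (b + 1) < P.count b := by
            have := hQ.2.antitone_count (Nat.le_succ b)
            simp only [hPQ.count_eq, List.count_cons] at *
            grind
          obtain ⟨T, v, hT, h⟩ := RowInsert.exists_left hP hb
          have hlen : T.length = n := by
            have := h.perm.length_eq
            rw [List.length_cons] at this; omega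
          have hv := h.le_length
          let t : TableauPair n :=
            ⟨(T, Q), hT, hQ.2, (h.perm.symm.trans hPQ).cons_inv, hlen⟩
          refine ⟨(⟨v, by omega⟩, Φ.symm t), ?_⟩
          have h' := hq (⟨v, by omega⟩, Φ.symm t)
          simp only [Equiv.apply_symm_apply] at h'
          obtain ⟨e1, e2⟩ := h'.unique h
          have e3 : (Φ (Φ.symm t)).1.2 = Q := by rw [Equiv.apply_symm_apply]
          exact Subtype.ext (Prod.ext e1 (congrArg₂ List.cons e2 e3))
    refine ⟨(PermWord.appendEquiv n).symm.trans (Equiv.ofBijective Ψ hΨ), fun w m j hj => ?_⟩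
    obtain ⟨p, rfl⟩ := (PermWord.appendEquiv n).surjective w
    rw [PermWord.coe_appendEquiv]
    simp only [Equiv.trans_apply, Equiv.symm_apply_apply, Equiv.ofBijective_apply]
    change _ ↔ m ∈ (q p).1.drop _
    have hlen := (Φ p.2).2.2.2.2
    have hv : (p.1 : ℕ) ≤ n := by omega
    rcases le_or_gt j p.1 with hjv | hjv
    · have hm := (hq p).drop_eq hjv
      rw [hlen] at hm
      rw [hasIncreasing_appendValue_of_le hjv, hΦ _ _ _ (by omega), hm]
    · obtain ⟨j, rfl⟩ : ∃ i, j = i + 1 := ⟨j - 1, by omega⟩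
      have hm := (hq p).mem_drop (j := j) (by omega) (by omega) m
      rw [hlen] at hm
      rw [hasIncreasing_appendValue_succ (by omega), Nat.add_sub_add_right, hm,
        hΦ _ _ _ (by omega)]
      refine or_congr_right ?_
      constructor
      · exact fun h m' hm' => (hΦ _ _ _ hv).1 (h.mono hm')
      · intro h
        cases m with
        | zero => exact ⟨∅, rfl, by simp [StrictMonoOn], by simp⟩
        | succ m => exact (hΦ _ _ _ hv).2 (h m (Nat.lt_succ_self m))

open Classical in
/-- The column words of standard Young tableaux of size `n` with at most `k` columns. -/
noncomputable def columnWords (k : ℕ) : ℕ → Finset (List ℕ)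
  | 0 => {[]}
  | n + 1 => ((Finset.range k ×ˢ columnWords k n).image fun p => p.1 :: p.2).filter
      fun T => ∀ i, T.count (i + 1) ≤ T.count i

theorem mem_columnWords {k n : ℕ} {T : List ℕ} :
    T ∈ columnWords k n ↔ Yamanouchi T ∧ T.length = n ∧ ∀ a ∈ T, a < k := by
  induction n generalizing T with
  | zero =>
    rw [columnWords, Finset.mem_singleton, List.length_eq_zero_iff]
    constructor
    · rintro rfl; simp [Yamanouchi]
    · exact fun h => h.2.1
  | succ n ih =>
    cases T with
    | nil => simp [columnWords]
    | cons a T =>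
      simp only [columnWords, Finset.mem_filter, Finset.mem_image, Finset.mem_product,
        Finset.mem_range, List.cons.injEq, Prod.exists, ih, Yamanouchi, List.length_cons,
        List.mem_cons, forall_eq_or_imp, Nat.add_right_cancel_iff]
      grind

open Classical in
theorem sum_columnWords_succ {M : Type*} [AddCommMonoid M] (k n : ℕ) (g : List ℕ → M) :
    ∑ T ∈ columnWords k (n + 1), g T = ∑ T ∈ columnWords k n, ∑ a ∈ Finset.range k,
      if ∀ i, (a :: T).count (i + 1) ≤ (a :: T).count i then g (a :: T) else 0 := by
  rw [columnWords, Finset.sum_filter, Finset.sum_image, Finset.sum_product_right]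
  rintro ⟨a, T⟩ - ⟨b, T'⟩ - h
  simpa using h

theorem card_words_eq (d n N : ℕ) (h : N = n) :
    Nat.card {w : Fin N → Fin n //
      (∀ v : Fin n, Nat.card {i : Fin N // w i = v} = 1) ∧ Avoids d w} =
    Nat.card {w : PermWord n // ¬ HasIncreasing w.1 d n} := by
  subst h
  refine Nat.card_congr ((Equiv.subtypeEquivRight fun w => ?_).trans
    (Equiv.subtypeSubtypeEquivSubtypeInter (fun w : Fin N → Fin N => Function.Injective w)
      (fun w => ¬ HasIncreasing w d N)).symm)
  rw [← not_avoids_iff, not_not]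
  refine and_congr_left fun _ => ?_
  constructor
  · intro hw i j hij
    have := (Nat.card_eq_one_iff_unique.1 (hw (w i))).1
    exact congrArg Subtype.val (Subsingleton.elim (⟨i, rfl⟩ : {i' // w i' = w i}) ⟨j, hij.symm⟩)
  · intro hw v
    obtain ⟨i, rfl⟩ := (Finite.injective_iff_surjective.1 hw) v
    exact Nat.card_eq_one_iff_unique.2
      ⟨⟨fun a b => Subtype.ext (hw (a.2.trans b.2.symm))⟩, ⟨⟨i, rfl⟩⟩⟩

/-- The exponent vector `λ + δ` of the alternant attached to a column word of shape `λ`. -/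
def exponents (k : ℕ) (T : List ℕ) (i : Fin k) : ℕ := T.count (i : ℕ) + i.rev

theorem exponents_strictAnti {k : ℕ} {T : List ℕ} (hT : Yamanouchi T) :
    StrictAnti (exponents k T) := fun _ _ hij =>
  add_lt_add_of_le_of_lt (hT.antitone_count (Fin.lt_def.1 hij).le)
    (Fin.lt_def.1 (Fin.rev_lt_rev.2 hij))

theorem sum_exponents {k n : ℕ} {T : List ℕ} (hT : T ∈ columnWords k n) :
    ∑ i, exponents k T i = n + ∑ i : Fin k, (i.rev : ℕ) := by
  obtain ⟨-, hn, hk⟩ := mem_columnWords.1 hT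
  simp only [exponents, Finset.sum_add_distrib]
  rw [Fin.sum_univ_eq_sum_range (fun i => T.count i), ← hn]
  congr 1
  simpa using Multiset.sum_count_eq_card (s := Finset.range k) (m := (T : Multiset ℕ))
    (by simpa using hk)

theorem exponents_eq_iff {k n : ℕ} {P Q : List ℕ} (hP : P ∈ columnWords k n)
    (hQ : Q ∈ columnWords k n) : exponents k P = exponents k Q ↔ P.Perm Q := by
  rw [List.perm_iff_count]
  constructor
  · intro h a
    by_cases ha : a < k
    · simpa [exponents] using congrFun h ⟨a, ha⟩
    · rw [List.count_eq_zero.2 fun h => ha ((mem_columnWords.1 hP).2.2 a h),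
        List.count_eq_zero.2 fun h => ha ((mem_columnWords.1 hQ).2.2 a h)]
  · exact fun h => funext fun i => by rw [exponents, exponents, h]

theorem A_eq_sum (k n : ℕ) :
    A (k + 1) 1 n = ∑ P ∈ columnWords k n, ∑ Q ∈ columnWords k n,
      if exponents k P = exponents k Q then 1 else 0 := by
  obtain ⟨Φ, hΦ⟩ := exists_robinsonSchensted n
  rw [A, card_words_eq _ _ _ (mul_one n), ← Finset.sum_product', ← Finset.card_filter,
    ← Nat.card_eq_finsetCard]
  refine Nat.card_congr ((Φ.subtypeEquiv (q := fun t => k ∉ t.1.1) fun w => ?_).trans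
    ((Equiv.subtypeSubtypeEquivSubtypeInter _ fun p : List ℕ × List ℕ => k ∉ p.1).trans
      (Equiv.subtypeEquivRight fun p => ?_)))
  · rw [hΦ w k n le_rfl, Nat.sub_self, List.drop_zero]
  · rw [Finset.mem_filter, Finset.mem_product]
    constructor
    · rintro ⟨⟨h1, h2, h3, h4⟩, h5⟩
      have hk : ∀ a ∈ p.1, a < k := fun a ha => by
        by_contra hka
        have h6 := h1.antitone_count (not_lt.1 hka)
        simp only [List.count_eq_zero.2 h5] at h6
        exact (List.count_pos_iff.2 ha).not_ge h6
      have hP := mem_columnWords.2 ⟨h1, h4, hk⟩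
      have hQ := mem_columnWords.2 ⟨h2, h3.length_eq ▸ h4, fun a ha => hk a (h3.mem_iff.2 ha)⟩
      exact ⟨⟨hP, hQ⟩, (exponents_eq_iff hP hQ).2 h3⟩
    · rintro ⟨⟨hP, hQ⟩, h⟩
      obtain ⟨h1, h2, h3⟩ := mem_columnWords.1 hP
      exact ⟨⟨h1, (mem_columnWords.1 hQ).1, (exponents_eq_iff hP hQ).1 h, h2⟩,
        fun hk => (h3 k hk).false⟩

/-- The alternant `det (x i ^ α j)`. -/
noncomputable def alternant {k : ℕ} (x : Fin k → ℂ) (α : Fin k → ℕ) : ℂ :=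
  (Matrix.of fun j i => x i ^ α j).det

theorem alternant_eq {k : ℕ} (x : Fin k → ℂ) (α : Fin k → ℕ) :
    alternant x α = ∑ σ : Equiv.Perm (Fin k), ((σ.sign : ℤ) : ℂ) * ∏ i, x i ^ α (σ i) := by
  rw [alternant, Matrix.det_apply']
  rfl

theorem sum_mul_alternant {k : ℕ} (x : Fin k → ℂ) (α : Fin k → ℕ) :
    (∑ i, x i) * alternant x α =
      ∑ a, alternant x fun j => α j + if j = a then 1 else 0 := by
  simp only [alternant_eq]
  rw [Finset.sum_comm, Finset.mul_sum]
  refine Finset.sum_congr rfl fun σ _ => ?_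
  have h : ∑ a, ∏ i, x i ^ (α (σ i) + if σ i = a then 1 else 0) =
      (∏ i, x i ^ α (σ i)) * ∑ i, x i := by
    rw [← Equiv.sum_comp σ, Finset.mul_sum]
    simp [pow_add, Finset.prod_mul_distrib, -mul_ite, -ite_mul]
  rw [← Finset.mul_sum, h]
  ring

theorem pow_mul_alternant (k n : ℕ) (x : Fin k → ℂ) :
    (∑ i, x i) ^ n * alternant x (exponents k []) =
      ∑ T ∈ columnWords k n, alternant x (exponents k T) := by
  induction n with
  | zero => simp [columnWords]
  | succ n ih =>
    rw [pow_succ', mul_assoc, ih, sum_columnWords_succ, Finset.mul_sum]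
    refine Finset.sum_congr rfl fun T hT => ?_
    rw [sum_mul_alternant, Finset.sum_range]
    refine Finset.sum_congr rfl fun a _ => ?_
    have he : (fun j => exponents k T j + if j = a then 1 else 0) =
        exponents k ((a : ℕ) :: T) := by
      ext j
      simp only [exponents, List.count_cons, beq_iff_eq, Fin.ext_iff, eq_comm (a := (j : ℕ))]
      ring
    rw [he]
    split_ifs with h
    · rfl
    · push Not at h
      obtain ⟨i, hi⟩ := h
      have h1 := (mem_columnWords.1 hT).1.antitone_count (Nat.le_succ i)
      have hia : (a : ℕ) = i + 1 := by
        simp only [List.count_cons] at *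
        grind
      have hcount : T.count (i + 1) = T.count i := by
        simp only [List.count_cons] at *
        grind
      have hk : i < k := by omega
      rw [alternant]
      refine Matrix.det_zero_of_row_eq (i := ⟨i, hk⟩) (j := a) ?_ ?_
      · simp [Fin.ext_iff, hia]
      · ext j
        simp only [Matrix.of_apply, exponents, List.count_cons, hia, hcount, Fin.val_rev]
        congr 1
        simp
        omega

open MeasureTheory

/-- The point of the torus with angles `0, φ 0, φ 1, ...`. -/
noncomputable def torusPoint {m : ℕ} (φ : Fin m → ℝ) (i : Fin (m + 1)) : ℂ :=
  Complex.exp ((Fin.cons 0 φ : Fin (m + 1) → ℝ) i * Complex.I)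

/-- The cube of angles. -/
noncomputable def angleCube (m : ℕ) : Set (Fin m → ℝ) :=
  Set.univ.pi fun _ => Set.Icc (-Real.pi) Real.pi

theorem isCompact_angleCube (m : ℕ) : IsCompact (angleCube m) :=
  isCompact_univ_pi fun _ => isCompact_Icc

theorem continuous_torusPoint {m : ℕ} (i : Fin (m + 1)) :
    Continuous fun φ : Fin m → ℝ => torusPoint φ i := by
  unfold torusPoint
  induction i using Fin.cases with
  | zero => simp only [Fin.cons_zero]; fun_prop
  | succ i => simp only [Fin.cons_succ]; fun_prop

theorem integral_exp_int (c : ℤ) :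
    ∫ t in Set.Icc (-Real.pi) Real.pi, Complex.exp (c * t * Complex.I) =
      if c = 0 then (2 * Real.pi : ℂ) else 0 := by
  rw [integral_Icc_eq_integral_Ioc, ← intervalIntegral.integral_of_le (by linarith [Real.pi_pos])]
  split_ifs with h
  · simp [h]; ring
  · have hc : (c * Complex.I : ℂ) ≠ 0 := mul_ne_zero (by exact_mod_cast h) Complex.I_ne_zero
    have : ∀ t : ℝ, (c * t * Complex.I : ℂ) = c * Complex.I * t := fun t => by ring
    simp only [this]
    rw [integral_exp_mul_complex hc, div_eq_zero_iff, sub_eq_zero]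
    left
    rw [Complex.exp_eq_exp_iff_exists_int]
    exact ⟨c, by push_cast; ring⟩

theorem integral_monomial {m : ℕ} (a b : Fin (m + 1) → ℕ) (hab : ∑ i, a i = ∑ i, b i) :
    ∫ φ in angleCube m, (∏ i, torusPoint φ i ^ a i) *
      (starRingEnd ℂ) (∏ i, torusPoint φ i ^ b i) =
      if a = b then (2 * Real.pi : ℂ) ^ m else 0 := by
  have h1 : ∀ φ : Fin m → ℝ, (∏ i, torusPoint φ i ^ a i) *
      (starRingEnd ℂ) (∏ i, torusPoint φ i ^ b i) =
      ∏ j : Fin m, Complex.exp (((a j.succ - b j.succ : ℤ) : ℂ) * φ j * Complex.I) := by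
    intro φ
    rw [map_prod, ← Finset.prod_mul_distrib, Fin.prod_univ_succ]
    simp only [torusPoint, Fin.cons_zero, Fin.cons_succ, Complex.ofReal_zero, zero_mul,
      Complex.exp_zero, one_pow, map_one, mul_one, one_mul, ← Complex.exp_conj,
      ← Complex.exp_nat_mul, ← Complex.exp_add]
    refine Finset.prod_congr rfl fun j _ => ?_
    congr 1
    simp
    ring
  simp only [h1]
  rw [angleCube, volume_pi, Measure.restrict_pi_pi]
  rw [integral_fintype_prod_eq_prod
    (f := fun (j : Fin m) (t : ℝ) =>
      Complex.exp (((a j.succ - b j.succ : ℤ) : ℂ) * t * Complex.I))]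
  simp only [integral_exp_int]
  split_ifs with h
  · simp [h]
  · have : ∃ j : Fin m, a j.succ ≠ b j.succ := by
      by_contra! h'
      apply h
      ext i
      induction i using Fin.cases with
      | zero =>
        rw [Fin.sum_univ_succ, Fin.sum_univ_succ] at hab
        simpa [h'] using hab
      | succ i => exact h' i
    obtain ⟨j, hj⟩ := this
    refine Finset.prod_eq_zero (Finset.mem_univ j) (if_neg ?_)
    omega

theorem comp_perm_eq_iff {k : ℕ} {α β : Fin k → ℕ} (hα : StrictAnti α) (hβ : StrictAnti β)
    (σ τ : Equiv.Perm (Fin k)) : α ∘ σ = β ∘ τ ↔ α = β ∧ σ = τ := by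
  constructor
  · intro h
    have h' : ∀ i, α i = β ((τ * σ⁻¹) i) := fun i => by
      simpa using congrFun h (σ⁻¹ i)
    have hmono : StrictMono (τ * σ⁻¹ : Equiv.Perm (Fin k)) := fun i j hij => by
      have := hα hij
      rw [h', h'] at this
      exact hβ.lt_iff_gt.1 this
    have h1 : ⇑(τ * σ⁻¹ : Equiv.Perm (Fin k)) = id :=
      (hmono.range_inj strictMono_id).1 (by simp only [Equiv.range_eq_univ, Set.range_id])
    have h2 : τ * σ⁻¹ = 1 := Equiv.ext fun i => congrFun h1 i
    refine ⟨funext fun i => ?_, (mul_inv_eq_one.1 h2).symm⟩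
    rw [h', h1, id]
  · rintro ⟨rfl, rfl⟩; rfl

theorem integral_alternant {m : ℕ} {α β : Fin (m + 1) → ℕ} (hα : StrictAnti α)
    (hβ : StrictAnti β) (hab : ∑ i, α i = ∑ i, β i) :
    ∫ φ in angleCube m, alternant (torusPoint φ) α *
      (starRingEnd ℂ) (alternant (torusPoint φ) β) =
      if α = β then ((m + 1).factorial * (2 * Real.pi) ^ m : ℂ) else 0 := by
  have hcont := @continuous_torusPoint m
  have hexp : ∀ φ : Fin m → ℝ, alternant (torusPoint φ) α *
      (starRingEnd ℂ) (alternant (torusPoint φ) β) =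
      ∑ σ : Equiv.Perm (Fin (m + 1)), ∑ τ : Equiv.Perm (Fin (m + 1)),
        (((σ.sign : ℤ) : ℂ) * ((τ.sign : ℤ) : ℂ)) * ((∏ i, torusPoint φ i ^ (α ∘ σ) i) *
          (starRingEnd ℂ) (∏ i, torusPoint φ i ^ (β ∘ τ) i)) := by
    intro φ
    rw [alternant_eq, alternant_eq, map_sum, Finset.sum_mul_sum]
    refine Finset.sum_congr rfl fun σ _ => Finset.sum_congr rfl fun τ _ => ?_
    rw [map_mul, map_intCast]
    simp only [Function.comp]
    ring
  have hsum : ∀ σ τ : Equiv.Perm (Fin (m + 1)), ∑ i, (α ∘ σ) i = ∑ i, (β ∘ τ) i :=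
    fun σ τ => by
      simp only [Function.comp]
      rw [Equiv.sum_comp σ α, Equiv.sum_comp τ β, hab]
  have hint : ∀ σ τ : Equiv.Perm (Fin (m + 1)), IntegrableOn (fun φ : Fin m → ℝ =>
      (((σ.sign : ℤ) : ℂ) * ((τ.sign : ℤ) : ℂ)) * ((∏ i, torusPoint φ i ^ (α ∘ σ) i) *
          (starRingEnd ℂ) (∏ i, torusPoint φ i ^ (β ∘ τ) i))) (angleCube m) := fun σ τ => by
    refine Continuous.continuousOn ?_ |>.integrableOn_compact (isCompact_angleCube m)
    simp only [map_prod, map_pow]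
    have hconj : ∀ i, Continuous fun φ : Fin m → ℝ => (starRingEnd ℂ) (torusPoint φ i) :=
      fun i => Complex.continuous_conj.comp (hcont i)
    fun_prop
  simp only [hexp]
  rw [integral_finsetSum _ fun σ _ => integrable_finsetSum _ fun τ _ => hint σ τ]
  have : ∀ σ : Equiv.Perm (Fin (m + 1)), ∫ φ in angleCube m,
      ∑ τ : Equiv.Perm (Fin (m + 1)),
        (((σ.sign : ℤ) : ℂ) * ((τ.sign : ℤ) : ℂ)) * ((∏ i, torusPoint φ i ^ (α ∘ σ) i) *
          (starRingEnd ℂ) (∏ i, torusPoint φ i ^ (β ∘ τ) i)) =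
      if α = β then (2 * Real.pi : ℂ) ^ m else 0 := fun σ => by
    rw [integral_finsetSum _ fun τ _ => hint σ τ]
    simp only [integral_const_mul, integral_monomial _ _ (hsum σ _), comp_perm_eq_iff hα hβ]
    split_ifs with h
    · simp only [h, true_and, mul_ite, mul_zero, Finset.sum_ite_eq, Finset.mem_univ, if_true]
      rw [← Int.cast_mul, Int.units_coe_mul_self]
      simp
    · simp [h]
  simp only [this]
  split_ifs
  · simp [Fintype.card_perm]
  · simp

/-- The count as a torus integral. -/
theorem integral_eq_A (m n : ℕ) :
    ∫ φ in angleCube m, ‖(∑ i, torusPoint φ i) ^ n *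
      alternant (torusPoint φ) (exponents (m + 1) [])‖ ^ 2 =
      (m + 1).factorial * (2 * Real.pi) ^ m * A (m + 2) 1 n := by
  have hcont : ∀ α, Continuous fun φ : Fin m → ℝ => alternant (torusPoint φ) α := fun α => by
    have := @continuous_torusPoint m
    simp only [alternant_eq]
    fun_prop
  have hint : ∀ P Q : List ℕ, IntegrableOn (fun φ : Fin m → ℝ =>
      alternant (torusPoint φ) (exponents (m + 1) P) *
        (starRingEnd ℂ) (alternant (torusPoint φ) (exponents (m + 1) Q))) (angleCube m) :=
    fun P Q => ((hcont _).mul (Complex.continuous_conj.comp (hcont _))).continuousOn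
      |>.integrableOn_compact (isCompact_angleCube m)
  apply Complex.ofReal_injective
  rw [← integral_complex_ofReal]
  have hexp : ∀ φ : Fin m → ℝ, ((‖(∑ i, torusPoint φ i) ^ n *
      alternant (torusPoint φ) (exponents (m + 1) [])‖ ^ 2 : ℝ) : ℂ) =
      ∑ P ∈ columnWords (m + 1) n, ∑ Q ∈ columnWords (m + 1) n,
        alternant (torusPoint φ) (exponents (m + 1) P) *
        (starRingEnd ℂ) (alternant (torusPoint φ) (exponents (m + 1) Q)) := fun φ => by
    rw [Complex.ofReal_pow, ← Complex.mul_conj', pow_mul_alternant, map_sum, Finset.sum_mul_sum]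
  rw [integral_congr_ae (ae_of_all _ hexp)]
  rw [integral_finsetSum _ fun P _ => integrable_finsetSum _ fun Q _ => hint P Q, A_eq_sum]
  push_cast
  rw [Finset.mul_sum]
  refine Finset.sum_congr rfl fun P hP => ?_
  rw [integral_finsetSum _ fun Q _ => hint P Q, Finset.mul_sum]
  refine Finset.sum_congr rfl fun Q hQ => ?_
  rw [integral_alternant (exponents_strictAnti (mem_columnWords.1 hP).1)
    (exponents_strictAnti (mem_columnWords.1 hQ).1) (by rw [sum_exponents hP, sum_exponents hQ])]
  split_ifs <;> simp

/-- The angles `0, φ 0, φ 1, ...` of a point of the torus. -/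
def angles {m : ℕ} (φ : Fin m → ℝ) : Fin (m + 1) → ℝ := Fin.cons 0 φ

theorem continuous_angles {m : ℕ} (i : Fin (m + 1)) :
    Continuous fun φ : Fin m → ℝ => angles φ i := by
  unfold angles
  induction i using Fin.cases with
  | zero => simp only [Fin.cons_zero]; fun_prop
  | succ i => simp only [Fin.cons_succ]; fun_prop

theorem angles_smul {m : ℕ} (c : ℝ) (φ : Fin m → ℝ) (i : Fin (m + 1)) :
    angles (c • φ) i = c * angles φ i := by
  unfold angles
  induction i using Fin.cases <;> simp

theorem norm_sq_sum_torusPoint {m : ℕ} (φ : Fin m → ℝ) :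
    ‖∑ i, torusPoint φ i‖ ^ 2 = ∑ i, ∑ j, Real.cos (angles φ i - angles φ j) := by
  have h : ∀ i, torusPoint φ i =
      ⟨Real.cos (angles φ i), Real.sin (angles φ i)⟩ := fun i => by
    apply Complex.ext <;> simp [torusPoint, angles, Complex.exp_ofReal_mul_I_re,
      Complex.exp_ofReal_mul_I_im]
  rw [← Complex.normSq_eq_norm_sq, Complex.normSq_apply, Complex.re_sum, Complex.im_sum,
    Finset.sum_mul_sum, Finset.sum_mul_sum, ← Finset.sum_add_distrib]
  simp only [← Finset.sum_add_distrib, h, Real.cos_sub]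

theorem norm_sq_torusPoint_sub {m : ℕ} (φ : Fin m → ℝ) (i j : Fin (m + 1)) :
    ‖torusPoint φ i - torusPoint φ j‖ ^ 2 = 2 * (1 - Real.cos (angles φ i - angles φ j)) := by
  rw [← Complex.normSq_eq_norm_sq, Complex.normSq_apply, Real.cos_sub]
  simp only [torusPoint, angles, Complex.sub_re, Complex.sub_im, Complex.exp_ofReal_mul_I_re,
    Complex.exp_ofReal_mul_I_im]
  nlinarith [Real.sin_sq_add_cos_sq ((Fin.cons 0 φ : Fin (m + 1) → ℝ) i),
    Real.sin_sq_add_cos_sq ((Fin.cons 0 φ : Fin (m + 1) → ℝ) j)]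

theorem norm_sq_alternant {m : ℕ} (φ : Fin m → ℝ) :
    ‖alternant (torusPoint φ) (exponents (m + 1) [])‖ ^ 2 =
      ∏ i, ∏ j ∈ Finset.Ioi i, 2 * (1 - Real.cos (angles φ j - angles φ i)) := by
  have h : alternant (torusPoint φ) (exponents (m + 1) []) =
      ((Matrix.vandermonde (torusPoint φ)).transpose.submatrix Fin.revPerm id).det := by
    rw [alternant]
    congr 1
    ext j i
    simp [exponents, Matrix.vandermonde]
  rw [h, Matrix.det_permute, Matrix.det_transpose, Matrix.det_vandermonde, norm_mul]
  have hs : ‖((Equiv.Perm.sign (Fin.revPerm (n := m + 1)) : ℤ) : ℂ)‖ = 1 := by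
    rcases Int.units_eq_one_or (Equiv.Perm.sign (Fin.revPerm (n := m + 1))) with h | h <;>
      simp [h]
  rw [hs, one_mul, norm_prod, ← Finset.prod_pow]
  refine Finset.prod_congr rfl fun i _ => ?_
  rw [norm_prod, ← Finset.prod_pow]
  exact Finset.prod_congr rfl fun j _ => norm_sq_torusPoint_sub φ j i

theorem one_sub_cos_le (y : ℝ) : 1 - Real.cos y ≤ y ^ 2 / 2 := by
  linarith [Real.one_sub_sq_div_two_le_cos (x := y)]

theorem mul_one_sub_cos_le {n : ℕ} (hn : 0 < n) (s : ℝ) :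
    n * (1 - Real.cos ((√n)⁻¹ * s)) ≤ s ^ 2 / 2 := by
  have h0 : (0 : ℝ) < n := by exact_mod_cast hn
  calc n * (1 - Real.cos ((√n)⁻¹ * s)) ≤ n * (((√n)⁻¹ * s) ^ 2 / 2) := by
        gcongr; exact one_sub_cos_le _
    _ = s ^ 2 / 2 := by
        rw [mul_pow, inv_pow, Real.sq_sqrt h0.le]; field_simp

theorem tendsto_inv_sqrt_natCast : Tendsto (fun n : ℕ => (√(n : ℝ))⁻¹) atTop (nhds 0) :=
  (Real.tendsto_sqrt_atTop.comp tendsto_natCast_atTop_atTop).inv_tendsto_atTop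

theorem tendsto_mul_one_sub_cos (s : ℝ) :
    Tendsto (fun n : ℕ => n * (1 - Real.cos ((√n)⁻¹ * s))) atTop (nhds (s ^ 2 / 2)) := by
  have h1 : Tendsto (fun n : ℕ => Real.sinc ((√n)⁻¹ * s / 2) ^ 2 * (s ^ 2 / 2)) atTop
      (nhds (Real.sinc (0 * s / 2) ^ 2 * (s ^ 2 / 2))) :=
    ((Real.continuous_sinc.tendsto _).comp
      ((tendsto_inv_sqrt_natCast.mul_const s).div_const 2)).pow 2 |>.mul_const _
  simp only [zero_mul, zero_div, Real.sinc_zero, one_pow, one_mul] at h1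
  refine h1.congr' ?_
  filter_upwards [eventually_gt_atTop 0] with n hn
  have h0 : (0 : ℝ) < n := by exact_mod_cast hn
  have hy : (√(n : ℝ))⁻¹ * s = 2 * ((√(n : ℝ))⁻¹ * s / 2) := by ring
  by_cases hs : s = 0
  · simp [hs]
  · have hr : √(n : ℝ) ≠ 0 := (Real.sqrt_pos.2 h0).ne'
    rw [Real.sinc_of_ne_zero (by positivity), div_pow, hy, Real.cos_two_mul, Real.cos_sq']
    have : ((√(n : ℝ))⁻¹ * s / 2) ^ 2 = s ^ 2 / (4 * n) := by
      rw [div_pow, mul_pow, inv_pow, Real.sq_sqrt h0.le]; field_simp; norm_num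
    rw [← hy, this]
    field_simp
    ring

theorem sum_angles_sq {m : ℕ} (φ : Fin m → ℝ) : ∑ i, angles φ i ^ 2 = ∑ i, φ i ^ 2 := by
  rw [Fin.sum_univ_succ]; simp [angles]

theorem angles_sub_sq_le {m : ℕ} (φ : Fin m → ℝ) {i j : Fin (m + 1)} (h : i ≠ j) :
    (angles φ i - angles φ j) ^ 2 ≤ 2 * ∑ l, φ l ^ 2 := by
  have : ∑ l ∈ {i, j}, angles φ l ^ 2 ≤ ∑ l, angles φ l ^ 2 :=
    Finset.sum_le_sum_of_subset_of_nonneg (Finset.subset_univ _) fun _ _ _ => sq_nonneg _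
  rw [Finset.sum_pair h, sum_angles_sq] at this
  nlinarith [sq_nonneg (angles φ i + angles φ j)]

theorem sum_cos_le {m : ℕ} {φ : Fin m → ℝ} (hφ : φ ∈ angleCube m) :
    ∑ i, ∑ j, Real.cos (angles φ i - angles φ j) ≤
      ((m : ℝ) + 1) ^ 2 - 2 / Real.pi ^ 2 * ∑ l, φ l ^ 2 := by
  rw [Fin.sum_univ_succ]
  have h1 : ∑ j, Real.cos (angles φ 0 - angles φ j) ≤
      ((m : ℝ) + 1) - 2 / Real.pi ^ 2 * ∑ l, φ l ^ 2 := by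
    rw [Fin.sum_univ_succ]
    have : ∑ j : Fin m, Real.cos (angles φ 0 - angles φ j.succ) ≤
        ∑ j : Fin m, (1 - 2 / Real.pi ^ 2 * φ j ^ 2) := by
      refine Finset.sum_le_sum fun j _ => ?_
      have hj := hφ j (Set.mem_univ _)
      simpa [angles] using Real.cos_le_one_sub_mul_cos_sq (abs_le.2 hj)
    rw [Finset.sum_sub_distrib, ← Finset.mul_sum] at this
    simp only [sub_self, Real.cos_zero, Finset.sum_const, Finset.card_univ, Fintype.card_fin,
      nsmul_eq_mul, mul_one] at this ⊢
    linarith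
  have h2 : ∑ i : Fin m, ∑ j, Real.cos (angles φ i.succ - angles φ j) ≤
      ∑ _i : Fin m, ∑ _j : Fin (m + 1), (1 : ℝ) :=
    Finset.sum_le_sum fun i _ => Finset.sum_le_sum fun j _ => Real.cos_le_one _
  simp only [Finset.sum_const, Finset.card_univ, Fintype.card_fin, nsmul_eq_mul, mul_one] at h2
  push_cast at h2
  linarith

/-- The number of positive roots: the degree of the Vandermonde determinant. -/
theorem sum_card_Ioi (m : ℕ) : 2 * ∑ i : Fin (m + 1), (Finset.Ioi i).card = m * (m + 1) := by
  have : ∑ i : Fin (m + 1), (Finset.Ioi i).card = ∑ i : Fin (m + 1), (i : ℕ) := by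
    rw [← Equiv.sum_comp Fin.revPerm]
    refine Finset.sum_congr rfl fun i _ => ?_
    rw [Fin.card_Ioi]; simp; omega
  rw [this, Fin.sum_univ_eq_sum_range (fun i => i), mul_comm, Finset.sum_range_id_mul_two,
    Nat.add_sub_cancel, mul_comm]

/-- The rescaled integrand. -/
noncomputable def scaledIntegrand (m n : ℕ) (t : Fin m → ℝ) : ℝ :=
  ((fun u => (√(n : ℝ))⁻¹ • u) ⁻¹' angleCube m).indicator (fun t =>
    ((∑ i, ∑ j, Real.cos ((√(n : ℝ))⁻¹ * (angles t i - angles t j))) / ((m : ℝ) + 1) ^ 2) ^ n *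
    ∏ i, ∏ j ∈ Finset.Ioi i,
      (2 * (n * (1 - Real.cos ((√(n : ℝ))⁻¹ * (angles t j - angles t i)))))) t

/-- The limiting Gaussian density. -/
noncomputable def limitIntegrand (m : ℕ) (t : Fin m → ℝ) : ℝ :=
  Real.exp (-(∑ i, ∑ j, (angles t i - angles t j) ^ 2 / 2) / ((m : ℝ) + 1) ^ 2) *
    ∏ i, ∏ j ∈ Finset.Ioi i, (2 * ((angles t j - angles t i) ^ 2 / 2))

theorem A_mul_eq_integral (m : ℕ) {n : ℕ} (hn : 0 < n) :
    (A (m + 2) 1 n : ℝ) * (n : ℝ) ^ ((((m : ℝ) + 1) ^ 2 - 1) / 2) / ((m : ℝ) + 1) ^ (2 * n) =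
      (((m + 1).factorial : ℝ) * (2 * Real.pi) ^ m)⁻¹ * ∫ t, scaledIntegrand m n t := by
  have h0 : (0 : ℝ) < n := by exact_mod_cast hn
  have hr : 0 < √(n : ℝ) := Real.sqrt_pos.2 h0
  set F : (Fin m → ℝ) → ℝ := (angleCube m).indicator fun φ =>
    ‖(∑ i, torusPoint φ i) ^ n * alternant (torusPoint φ) (exponents (m + 1) [])‖ ^ 2 with hF
  set M := ∑ i : Fin (m + 1), (Finset.Ioi i).card with hM
  have hpow : (n : ℝ) ^ ((((m : ℝ) + 1) ^ 2 - 1) / 2) = √(n : ℝ) ^ m * (n : ℝ) ^ M := by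
    have hM2 : (2 * M : ℝ) = m * (m + 1) := by exact_mod_cast sum_card_Ioi m
    rw [Real.sqrt_eq_rpow, ← Real.rpow_natCast ((n : ℝ) ^ (1 / 2 : ℝ)),
      ← Real.rpow_natCast (n : ℝ) M, ← Real.rpow_mul h0.le, ← Real.rpow_add h0]
    congr 1
    linarith
  have hG : ∀ t, scaledIntegrand m n t =
      (n : ℝ) ^ M / ((m : ℝ) + 1) ^ (2 * n) * F ((√(n : ℝ))⁻¹ • t) := by
    intro t
    rw [scaledIntegrand, hF]
    by_cases h : (√(n : ℝ))⁻¹ • t ∈ angleCube m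
    · rw [Set.indicator_of_mem (by exact h), Set.indicator_of_mem h, norm_mul, norm_pow, mul_pow,
        ← pow_mul, mul_comm n 2, pow_mul ‖_‖, norm_sq_sum_torusPoint, norm_sq_alternant]
      simp only [angles_smul, ← mul_sub, mul_left_comm (2 : ℝ) (n : ℝ), Finset.prod_mul_distrib,
        Finset.prod_const]
      rw [Finset.prod_pow_eq_pow_sum, div_pow, ← pow_mul]
      ring
    · rw [Set.indicator_of_notMem (by exact h), Set.indicator_of_notMem h, mul_zero]
  simp only [hG]
  rw [integral_const_mul, Measure.integral_comp_smul, hF, integral_indicator, integral_eq_A, hpow]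
  · have hpi := Real.pi_pos
    have hfac : ((m + 1).factorial : ℝ) ≠ 0 := by positivity
    rw [Module.finrank_fin_fun, inv_pow, inv_inv, abs_of_pos (by positivity), smul_eq_mul]
    field_simp
  · exact (isCompact_angleCube m).measurableSet

theorem tendsto_scaledIntegrand (m : ℕ) (t : Fin m → ℝ) :
    Tendsto (fun n => scaledIntegrand m n t) atTop (nhds (limitIntegrand m t)) := by
  have hmem : ∀ᶠ n : ℕ in atTop, (√(n : ℝ))⁻¹ • t ∈ angleCube m := by
    have h1 : Tendsto (fun n : ℕ => (√(n : ℝ))⁻¹ • t) atTop (nhds ((0 : ℝ) • t)) :=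
      tendsto_inv_sqrt_natCast.smul_const t
    rw [zero_smul] at h1
    refine h1.eventually (set_pi_mem_nhds Set.finite_univ fun i _ => ?_)
    exact Icc_mem_nhds (by simpa using Real.pi_pos) (by simpa using Real.pi_pos)
  have hk : (0 : ℝ) < ((m : ℝ) + 1) ^ 2 := by positivity
  have h1 : Tendsto (fun n : ℕ =>
      (1 + (-(∑ i, ∑ j, (1 - Real.cos ((√(n : ℝ))⁻¹ * (angles t i - angles t j)))) /
        ((m : ℝ) + 1) ^ 2)) ^ n) atTop
      (nhds (Real.exp (-(∑ i, ∑ j, (angles t i - angles t j) ^ 2 / 2) / ((m : ℝ) + 1) ^ 2))) := by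
    refine Real.tendsto_one_add_pow_exp_of_tendsto ?_
    have : Tendsto (fun n : ℕ =>
        -(∑ i, ∑ j, n * (1 - Real.cos ((√(n : ℝ))⁻¹ * (angles t i - angles t j)))) /
        ((m : ℝ) + 1) ^ 2) atTop
        (nhds (-(∑ i, ∑ j, (angles t i - angles t j) ^ 2 / 2) / ((m : ℝ) + 1) ^ 2)) :=
      (tendsto_finsetSum _ fun i _ => tendsto_finsetSum _ fun j _ =>
        tendsto_mul_one_sub_cos _).neg.div_const _
    refine this.congr fun n => ?_
    simp only [← Finset.mul_sum]
    ring
  have h2 : Tendsto (fun n : ℕ => ∏ i, ∏ j ∈ Finset.Ioi i,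
      (2 * (n * (1 - Real.cos ((√(n : ℝ))⁻¹ * (angles t j - angles t i)))))) atTop
      (nhds (∏ i, ∏ j ∈ Finset.Ioi i, (2 * ((angles t j - angles t i) ^ 2 / 2)))) :=
    tendsto_finsetProd _ fun i _ => tendsto_finsetProd _ fun j _ =>
      (tendsto_mul_one_sub_cos _).const_mul 2
  refine (h1.mul h2).congr' ?_
  filter_upwards [hmem] with n hn
  rw [scaledIntegrand, Set.indicator_of_mem (by exact hn)]
  congr 2
  simp only [Finset.sum_sub_distrib, Finset.sum_const, Finset.card_univ, Fintype.card_fin,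
    nsmul_eq_mul, mul_one]
  push_cast
  field_simp
  ring

theorem exists_bound_scaledIntegrand (m : ℕ) :
    ∃ K c : ℝ, 0 < c ∧ ∀ n, 0 < n → ∀ t : Fin m → ℝ,
      ‖scaledIntegrand m n t‖ ≤ K * Real.exp (-c * ∑ l, t l ^ 2) := by
  set M := ∑ i : Fin (m + 1), (Finset.Ioi i).card with hM
  set c : ℝ := 2 / Real.pi ^ 2 / ((m : ℝ) + 1) ^ 2 with hc
  have hpi := Real.pi_pos
  have hc0 : 0 < c := by positivity
  refine ⟨2 ^ M * (M.factorial / (c / 2) ^ M), c / 2, by positivity, fun n hn t => ?_⟩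
  have h0 : (0 : ℝ) < n := by exact_mod_cast hn
  set S := ∑ l, t l ^ 2 with hS
  have hS0 : 0 ≤ S := Finset.sum_nonneg fun _ _ => sq_nonneg _
  rw [scaledIntegrand, Set.indicator]
  split_ifs with hmem
  swap
  · rw [norm_zero]; positivity
  have hfac : ∀ s : ℝ, 0 ≤ 2 * ((n : ℝ) * (1 - Real.cos ((√(n : ℝ))⁻¹ * s))) := fun s => by
    have := Real.cos_le_one ((√(n : ℝ))⁻¹ * s)
    exact mul_nonneg zero_le_two (mul_nonneg h0.le (by linarith))
  have hV0 : 0 ≤ ∏ i, ∏ j ∈ Finset.Ioi i,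
      (2 * (n * (1 - Real.cos ((√(n : ℝ))⁻¹ * (angles t j - angles t i))))) :=
    Finset.prod_nonneg fun i _ => Finset.prod_nonneg fun j _ => hfac _
  have hV : ∏ i, ∏ j ∈ Finset.Ioi i,
      (2 * (n * (1 - Real.cos ((√(n : ℝ))⁻¹ * (angles t j - angles t i))))) ≤ (2 * S) ^ M := by
    rw [hM, ← Finset.prod_pow_eq_pow_sum]
    refine Finset.prod_le_prod (fun i _ => Finset.prod_nonneg fun j _ => hfac _) fun i _ => ?_
    rw [← Finset.prod_const]
    refine Finset.prod_le_prod (fun j _ => hfac _) fun j hj => ?_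
    have h1 := mul_one_sub_cos_le hn (angles t j - angles t i)
    have h2 := angles_sub_sq_le t (Finset.mem_Ioi.1 hj).ne'
    linarith
  have hcos : ∑ i, ∑ j, Real.cos ((√(n : ℝ))⁻¹ * (angles t i - angles t j)) =
      ∑ i, ∑ j, Real.cos (angles ((√(n : ℝ))⁻¹ • t) i - angles ((√(n : ℝ))⁻¹ • t) j) := by
    simp only [angles_smul, mul_sub]
  set D := (∑ i, ∑ j, Real.cos ((√(n : ℝ))⁻¹ * (angles t i - angles t j))) /
    ((m : ℝ) + 1) ^ 2 with hD
  have hD0 : 0 ≤ D := by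
    rw [hD, hcos, ← norm_sq_sum_torusPoint]; positivity
  have hD1 : D ≤ Real.exp (-(c * (S / n))) := by
    refine le_trans ?_ (Real.add_one_le_exp _)
    have hsum : ∑ l, ((√(n : ℝ))⁻¹ • t) l ^ 2 = S / n := by
      simp only [Pi.smul_apply, smul_eq_mul, mul_pow, inv_pow, Real.sq_sqrt h0.le]
      rw [← Finset.mul_sum]; ring
    have := sum_cos_le hmem
    rw [hsum, ← hcos] at this
    rw [hD, div_le_iff₀ (by positivity)]
    refine this.trans_eq ?_
    rw [hc]
    field_simp
    ring
  have hDn : D ^ n ≤ Real.exp (-(c * S)) := by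
    refine (pow_le_pow_left₀ hD0 hD1 n).trans_eq ?_
    rw [← Real.exp_nat_mul]
    congr 1
    field_simp
  rw [Real.norm_of_nonneg (mul_nonneg (pow_nonneg hD0 _) hV0)]
  have hexp := Real.pow_div_factorial_le_exp (x := c / 2 * S) (by positivity) M
  rw [mul_pow, div_le_iff₀ (by positivity)] at hexp
  have hSM : S ^ M ≤ M.factorial / (c / 2) ^ M * Real.exp (c / 2 * S) := by
    rw [div_mul_eq_mul_div, le_div_iff₀ (by positivity)]
    linarith
  calc _ ≤ Real.exp (-(c * S)) * (2 * S) ^ M := by gcongr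
    _ = 2 ^ M * (Real.exp (-(c * S)) * S ^ M) := by rw [mul_pow]; ring
    _ ≤ 2 ^ M * (Real.exp (-(c * S)) *
          (M.factorial / (c / 2) ^ M * Real.exp (c / 2 * S))) := by gcongr
    _ = 2 ^ M * (M.factorial / (c / 2) ^ M) *
          (Real.exp (-(c * S)) * Real.exp (c / 2 * S)) := by ring
    _ = _ := by
      rw [← Real.exp_add]
      congr 2
      ring

theorem integrable_gaussian_pi (m : ℕ) (K : ℝ) {c : ℝ} (hc : 0 < c) :
    Integrable fun t : Fin m → ℝ => K * Real.exp (-c * ∑ l, t l ^ 2) := by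
  refine Integrable.const_mul ?_ K
  have := Integrable.fintype_prod (f := fun (_ : Fin m) (x : ℝ) => Real.exp (-c * x ^ 2))
    (μ := fun _ => volume) fun _ => integrable_exp_neg_mul_sq hc
  rw [volume_pi]
  exact this.congr (ae_of_all _ fun t => by simp only [Finset.mul_sum, Real.exp_sum])

theorem continuous_limitIntegrand (m : ℕ) : Continuous (limitIntegrand m) := by
  have := @continuous_angles m
  unfold limitIntegrand
  fun_prop

theorem limitIntegrand_nonneg {m : ℕ} (t : Fin m → ℝ) : 0 ≤ limitIntegrand m t := by
  unfold limitIntegrand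
  positivity

theorem measurable_scaledIntegrand (m n : ℕ) : Measurable (scaledIntegrand m n) := by
  have := @continuous_angles m
  refine Measurable.indicator ?_ ?_
  · exact Continuous.measurable (by fun_prop)
  · exact (continuous_const_smul _).measurable (isCompact_angleCube m).measurableSet

theorem integral_limitIntegrand_pos (m : ℕ) : 0 < ∫ t, limitIntegrand m t := by
  obtain ⟨K, c, hc, hK⟩ := exists_bound_scaledIntegrand m
  have hint : Integrable (limitIntegrand m) := by
    refine (integrable_gaussian_pi m K hc).mono'
      (continuous_limitIntegrand m).aestronglyMeasurable (ae_of_all _ fun t => ?_)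
    refine le_of_tendsto (tendsto_scaledIntegrand m t).norm ?_
    filter_upwards [eventually_gt_atTop 0] with n hn using hK n hn t
  rw [integral_pos_iff_support_of_nonneg limitIntegrand_nonneg hint]
  refine (continuous_limitIntegrand m).isOpen_support.measure_pos volume
    ⟨fun i => (i : ℝ) + 1, ?_⟩
  have hang : ∀ i : Fin (m + 1), angles (fun i : Fin m => (i : ℝ) + 1) i = (i : ℕ) := fun i => by
    induction i using Fin.cases <;> simp [angles]
  rw [Function.mem_support, limitIntegrand]
  refine mul_ne_zero (Real.exp_pos _).ne' (Finset.prod_ne_zero_iff.2 fun i _ =>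
    Finset.prod_ne_zero_iff.2 fun j hj => ?_)
  have hij : ((i : ℕ) : ℝ) < (j : ℕ) := by exact_mod_cast Fin.lt_def.1 (Finset.mem_Ioi.1 hj)
  rw [hang, hang]
  have : 0 < ((j : ℕ) : ℝ) - (i : ℕ) := sub_pos.2 hij
  positivity

theorem tendsto_integral_scaledIntegrand (m : ℕ) :
    Tendsto (fun n => ∫ t, scaledIntegrand m n t) atTop (nhds (∫ t, limitIntegrand m t)) := by
  obtain ⟨K, c, hc, hK⟩ := exists_bound_scaledIntegrand m
  refine tendsto_integral_filter_of_dominated_convergence _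
    (.of_forall fun n => (measurable_scaledIntegrand m n).aestronglyMeasurable) ?_
    (integrable_gaussian_pi m K hc) (ae_of_all _ (tendsto_scaledIntegrand m))
  filter_upwards [eventually_gt_atTop 0] with n hn using ae_of_all _ (hK n hn)

/-- Regev's asymptotics: for every `d ≥ 2` there is a constant `C_d > 0` with
`A d 1 n ~ C_d · (d-1)^{2n} · n^{-((d-1)² - 1)/2}`. -/
theorem regev_asymptotics (d : ℕ) (hd : 2 ≤ d) :
    ∃ C : ℝ, 0 < C ∧
      Tendsto
        (fun n : ℕ =>
          (A d 1 n : ℝ) * (n : ℝ) ^ ((((d : ℝ) - 1) ^ 2 - 1) / 2) /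
            ((d : ℝ) - 1) ^ (2 * n))
        atTop (nhds C) := by
  obtain ⟨m, rfl⟩ : ∃ m, d = m + 2 := ⟨d - 2, by omega⟩
  have hd' : ((m + 2 : ℕ) : ℝ) - 1 = m + 1 := by push_cast; ring
  have hpi := Real.pi_pos
  refine ⟨(((m + 1).factorial : ℝ) * (2 * Real.pi) ^ m)⁻¹ * ∫ t, limitIntegrand m t,
    mul_pos (by positivity) (integral_limitIntegrand_pos m), ?_⟩
  refine ((tendsto_integral_scaledIntegrand m).const_mul _).congr' ?_
  filter_upwards [eventually_gt_atTop 0] with n hn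
  rw [hd', A_mul_eq_integral m hn]
end

section
/- For every integer k ≥ 1, the following identity of formal power series with rational coefficients holds: Σ_{n≥0} (u_k(n)/(n!)^2) x^{2n} = det( B_{|i-j|} )_{i,j = 1,...,k}, where u_k(n) denotes the number of permutations of {1,...,n} with no increasing subsequence of length exceeding k, the determinant is that of the k×k matrix whose (i,j) entry is the formal power series B_{|i-j|}, and for a natural number ν, B_ν = I_ν(2x) is the formal power series Σ_{j≥0} x^{2j+ν} / (j!·(j+ν)!). -/
/-- `u k n` is the number of permutations of `{1,...,n}` with no increasing
subsequence of length `k + 1`, i.e. whose longest increasing subsequence has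
length at most `k`. -/
noncomputable def u (k n : ℕ) : ℕ :=
  Nat.card {w : Equiv.Perm (Fin n) //
    ¬ ∃ s : Fin (k + 1) → Fin n, StrictMono s ∧ StrictMono (w ∘ s)}

/-- The modified Bessel function `I_ν(2x) = Σ_{j ≥ 0} x^{2j+ν} / (j!·(j+ν)!)`
as a formal power series over `ℚ`: the coefficient of `x^m` is `1/(j!·(j+ν)!)`
when `m = 2j + ν`, and `0` otherwise. -/
noncomputable def besselI2 (ν : ℕ) : PowerSeries ℚ :=
  PowerSeries.mk fun m =>
    if ν ≤ m ∧ m % 2 = ν % 2 then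
      1 / ((((m - ν) / 2).factorial : ℚ) * (((m - ν) / 2 + ν).factorial : ℚ))
    else 0

namespace Gessel

/-- `IsMove d S`: the particle of `S` at `d` can jump to the empty site `d + 1`. -/
def IsMove (d : ℕ) (S : Finset ℕ) : Prop := d ∈ S ∧ d + 1 ∉ S

/-- The configuration obtained from `S` by moving the particle at `d` to `d + 1`. -/
def move (d : ℕ) (S : Finset ℕ) : Finset ℕ := insert (d + 1) (S.erase d)

/-- `T` is obtained from `S` by one jump to the right. -/
def Up (S T : Finset ℕ) : Prop := ∃ d, IsMove d S ∧ T = move d S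

/-- `T` is obtained from `S` by at most one jump to the right. -/
def LazyUp (S T : Finset ℕ) : Prop := S = T ∨ Up S T

/-- Fomin's local rule for growth diagrams, in terms of particle configurations: `ρ` is the
lower left corner of a cell, `μ` and `ν` are its neighbours, `κ` is the opposite corner, and `b`
says whether the cell carries a cross. -/
inductive Cell (b : Prop) (ρ μ ν κ : Finset ℕ) : Prop
  | cross (r : ℕ) (hb : b) (hμ : μ = ρ) (hν : ν = ρ) (hrun : ∀ t ≤ r, t ∈ ρ) (hr : r + 1 ∉ ρ)
      (hκ : κ = move r ρ)
  | left (hb : ¬ b) (hμ : μ = ρ) (hκ : κ = ν) (h : LazyUp ρ ν)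
  | right (hb : ¬ b) (hν : ν = ρ) (hκ : κ = μ) (h : LazyUp ρ μ)
  | apart (d e : ℕ) (hb : ¬ b) (hd : IsMove d ρ) (he : IsMove e ρ) (hde : d ≠ e)
      (hμ : μ = move d ρ) (hν : ν = move e ρ) (hκ : κ = move e (move d ρ))
  | bump (d r : ℕ) (hb : ¬ b) (hd : IsMove d ρ) (hμ : μ = move d ρ) (hν : ν = μ) (hdr : d < r)
      (hrun : ∀ t, d < t → t ≤ r → t ∈ μ) (hr : r + 1 ∉ μ) (hκ : κ = move r μ)

lemma mem_move {d t : ℕ} {S : Finset ℕ} : t ∈ move d S ↔ t = d + 1 ∨ (t ≠ d ∧ t ∈ S) := by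
  simp [move]

lemma IsMove.move_ne {d : ℕ} {S : Finset ℕ} (h : IsMove d S) : move d S ≠ S := by
  intro e
  have := h.2
  rw [← e, mem_move] at this
  simp at this

lemma IsMove.inj {d e : ℕ} {S : Finset ℕ} (hd : IsMove d S) (h : move d S = move e S) :
    d = e := by
  by_contra hne
  have h1 : d + 1 ∈ move e S := by rw [← h, mem_move]; simp
  rw [mem_move] at h1
  rcases h1 with h1 | h1
  · omega
  · exact hd.2 h1.2

lemma IsMove.source_inj {d : ℕ} {S T : Finset ℕ} (hS : IsMove d S) (hT : IsMove d T)
    (h : move d S = move d T) : S = T := by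
  ext t
  have ht := congrArg (t ∈ ·) h
  simp only [mem_move, eq_iff_iff] at ht
  obtain ⟨h1, h2⟩ := hS
  obtain ⟨h3, h4⟩ := hT
  by_cases e1 : t = d
  · subst e1; simp [*]
  by_cases e2 : t = d + 1
  · subst e2; simp [*]
  · simpa [e1, e2] using ht

/-- The configuration in which the particle at `d + 1` is moved back to `d`. -/
def moveBack (d : ℕ) (S : Finset ℕ) : Finset ℕ := insert d (S.erase (d + 1))

lemma isMove_moveBack {d : ℕ} {S : Finset ℕ} : IsMove d (moveBack d S) := by
  simp [IsMove, moveBack]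

lemma move_moveBack {d : ℕ} {S : Finset ℕ} (h1 : d ∉ S) (h2 : d + 1 ∈ S) :
    move d (moveBack d S) = S := by
  ext t
  simp only [move, moveBack, Finset.mem_insert, Finset.mem_erase]
  grind

lemma up_of_isMove {d : ℕ} {S : Finset ℕ} (h : IsMove d S) : Up S (move d S) := ⟨d, h, rfl⟩

lemma Up.ne {S T : Finset ℕ} (h : Up S T) : S ≠ T := by
  obtain ⟨d, hd, rfl⟩ := h
  exact hd.move_ne.symm

lemma isMove_move {d e : ℕ} {S : Finset ℕ} (he : IsMove e S) (hde : d ≠ e) :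
    IsMove e (move d S) := by
  simp only [IsMove, mem_move] at *
  grind

lemma move_comm {d e : ℕ} {S : Finset ℕ} (hd : IsMove d S) (he : IsMove e S) :
    move e (move d S) = move d (move e S) := by
  ext t
  simp only [IsMove, mem_move] at *
  grind

lemma exists_run (S : Finset ℕ) {d : ℕ} (hd : d ∈ S) :
    ∃ r, d ≤ r ∧ (∀ t, d ≤ t → t ≤ r → t ∈ S) ∧ r + 1 ∉ S := by
  classical
  have hex : ∃ q, d ≤ q ∧ q + 1 ∉ S := by
    refine ⟨d + S.sup id, by omega, fun h => ?_⟩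
    have : d + S.sup id + 1 ≤ S.sup id := Finset.le_sup (f := id) h
    omega
  refine ⟨Nat.find hex, (Nat.find_spec hex).1, fun t ht htr => ?_, (Nat.find_spec hex).2⟩
  rcases ht.eq_or_lt with rfl | hlt
  · exact hd
  · have := Nat.find_min hex (m := t - 1) (by omega)
    by_contra h
    refine this ⟨by omega, ?_⟩
    rwa [Nat.sub_add_cancel (by omega)]

lemma Cell.lazyUp_left {b : Prop} {ρ μ ν κ : Finset ℕ} (h : Cell b ρ μ ν κ) : LazyUp ρ μ := by
  cases h with
  | cross r hb hμ => exact .inl hμ.symm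
  | left hb hμ => exact .inl hμ.symm
  | right hb hν hκ h => exact h
  | apart d e hb hd he hde hμ => exact .inr ⟨d, hd, hμ⟩
  | bump d r hb hd hμ => exact .inr ⟨d, hd, hμ⟩

lemma Cell.lazyUp_right {b : Prop} {ρ μ ν κ : Finset ℕ} (h : Cell b ρ μ ν κ) : LazyUp μ κ := by
  cases h with
  | cross r hb hμ hν hrun hr hκ =>
    subst hμ; exact .inr ⟨r, ⟨hrun r le_rfl, hr⟩, hκ⟩
  | left hb hμ hκ h => rwa [hμ, hκ]
  | right hb hν hκ h => exact .inl hκ.symm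
  | apart d e hb hd he hde hμ hν hκ =>
    subst hμ; exact .inr ⟨e, isMove_move he hde, hκ⟩
  | bump d r hb hd hμ hν hdr hrun hr hκ => exact .inr ⟨r, ⟨hrun r hdr le_rfl, hr⟩, hκ⟩

lemma Cell.symm {b : Prop} {ρ μ ν κ : Finset ℕ} (h : Cell b ρ μ ν κ) : Cell b ρ ν μ κ := by
  cases h with
  | cross r hb hμ hν hrun hr hκ => exact .cross r hb hν hμ hrun hr hκ
  | left hb hμ hκ h => exact .right hb hμ hκ h
  | right hb hν hκ h => exact .left hb hν hκ h
  | apart d e hb hd he hde hμ hν hκ =>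
    exact .apart e d hb he hd hde.symm hν hμ (hκ.trans (move_comm hd he))
  | bump d r hb hd hμ hν hdr hrun hr hκ =>
    subst hν; exact .bump d r hb hd hμ rfl hdr hrun hr hκ

lemma Cell.exists_forward {b : Prop} {ρ μ ν : Finset ℕ} (hμ : LazyUp ρ μ) (hν : LazyUp ρ ν)
    (hb : b → μ = ρ ∧ ν = ρ ∧ 0 ∈ ρ) : ∃ κ, Cell b ρ μ ν κ := by
  by_cases h : b
  · obtain ⟨h1, h2, h3⟩ := hb h
    obtain ⟨r, -, hrun, hr⟩ := exists_run ρ h3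
    exact ⟨_, .cross r h h1 h2 (fun t ht => hrun t (Nat.zero_le _) ht) hr rfl⟩
  rcases hμ with hμ | ⟨d, hd, hμ⟩
  · exact ⟨ν, .left h hμ.symm rfl hν⟩
  rcases hν with hν | ⟨e, he, hν⟩
  · exact ⟨μ, .right h hν.symm rfl (.inr ⟨d, hd, hμ⟩)⟩
  by_cases hde : d = e
  · subst hde
    obtain ⟨r, hdr, hrun, hr⟩ := exists_run μ (d := d + 1) (by rw [hμ, mem_move]; simp)
    exact ⟨_, .bump d r h hd hμ (hν.trans hμ.symm) hdr (fun t h1 h2 => hrun t h1 h2) hr rfl⟩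
  · exact ⟨_, .apart d e h hd he hde hμ hν rfl⟩

lemma Cell.exists_backward {μ ν κ : Finset ℕ} (hμ : LazyUp μ κ) (hν : LazyUp ν κ) :
    ∃ (b : Prop) (ρ : Finset ℕ), Cell b ρ μ ν κ := by
  classical
  rcases hμ with rfl | ⟨e, he, hκ⟩
  · exact ⟨False, ν, .right id rfl rfl hν⟩
  rcases hν with rfl | ⟨d, hd, hκ'⟩
  · exact ⟨False, μ, .left id rfl rfl (.inr ⟨e, he, hκ⟩)⟩
  by_cases hde : d = e
  · subst hde
    have hνμ : ν = μ := hd.source_inj he (hκ'.symm.trans hκ)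
    subst hνμ
    by_cases hrun : ∀ t ≤ d, t ∈ ν
    · exact ⟨True, ν, .cross d trivial rfl rfl hrun hd.2 hκ⟩
    · push Not at hrun
      obtain ⟨t, htd, ht⟩ := hrun
      set p := Nat.findGreatest (· ∉ ν) d with hp
      have hpν : p ∉ ν := Nat.findGreatest_spec (P := (· ∉ ν)) htd ht
      have hpd : p ≤ d := Nat.findGreatest_le d
      have hpd' : p ≠ d := fun h => hpν (h ▸ hd.1)
      have hgap : ∀ s, p < s → s ≤ d → s ∈ ν := fun s h1 h2 => by
        simpa using Nat.findGreatest_is_greatest (P := (· ∉ ν)) h1 h2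
      exact ⟨False, moveBack p ν, .bump p d id isMove_moveBack
        (move_moveBack hpν (hgap _ (by omega) (by omega))).symm rfl (by omega) hgap hd.2 hκ⟩
  · have hk : move e μ = move d ν := hκ.symm.trans hκ'
    have key : ∀ t, (t = e + 1 ∨ (t ≠ e ∧ t ∈ μ)) ↔ (t = d + 1 ∨ (t ≠ d ∧ t ∈ ν)) := fun t => by
      rw [← mem_move, ← mem_move, hk]
    have h1 : d ∉ μ := by have := key d; have := hd.1; have := hd.2; grind
    have h2 : d + 1 ∈ μ := by have := key (d + 1); grind
    have hmv := move_moveBack h1 h2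
    have heρ : IsMove e (moveBack d μ) := by
      have := he.1; have := he.2; have := key d; have := hd.1
      simp only [IsMove, moveBack, Finset.mem_insert, Finset.mem_erase]
      grind
    refine ⟨False, moveBack d μ, .apart d e id isMove_moveBack heρ hde hmv.symm ?_ (by rw [hmv, hκ])⟩
    apply hd.source_inj (isMove_move isMove_moveBack (Ne.symm hde))
    rw [move_comm heρ isMove_moveBack, hmv, hk]

lemma Cell.eq_of_left_eq {b : Prop} {ρ ν κ : Finset ℕ} (h : Cell b ρ ρ ν κ) (hb : ¬ b) :
    κ = ν := by
  cases h with
  | cross r h => exact absurd h hb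
  | left hb hμ hκ h => exact hκ
  | right hb hν hκ h => exact hκ.trans hν.symm
  | apart d e hb hd he hde hμ hν hκ => exact absurd hμ.symm hd.move_ne
  | bump d r hb hd hμ => exact absurd hμ.symm hd.move_ne

lemma Cell.up_right {b : Prop} {ρ μ ν κ : Finset ℕ} (h : Cell b ρ μ ν κ) (hb : b ∨ ρ ≠ μ) :
    Up ν κ := by
  refine h.symm.lazyUp_right.resolve_left ?_
  cases h with
  | cross r h hμ hν hrun hr hκ =>
    subst hν
    rw [hκ]
    exact (IsMove.move_ne ⟨hrun r le_rfl, hr⟩).symm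
  | left h hμ hκ => grind
  | right h hν hκ => grind
  | apart d e h hd he hde hμ hν hκ =>
    rw [hκ, hν, move_comm hd he]
    exact (isMove_move hd hde.symm).move_ne.symm
  | bump d r h hd hμ hν hdr hrun hr hκ =>
    rw [hν, hκ]
    exact (IsMove.move_ne ⟨hrun r hdr le_rfl, hr⟩).symm

lemma Cell.left_eq {b : Prop} {ρ μ ν κ : Finset ℕ} (h : Cell b ρ μ ν κ) (hb : b) : μ = ρ := by
  cases h <;> first | assumption | contradiction

lemma Cell.forward_unique {b : Prop} {ρ μ ν κ κ' : Finset ℕ} (h : Cell b ρ μ ν κ)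
    (h' : Cell b ρ μ ν κ') : κ = κ' := by
  cases h with
  | cross r hb hμ hν hrun hr hκ =>
    cases h' with
    | cross r' hb' hμ' hν' hrun' hr' hκ' =>
      obtain rfl : r = r' := by
        by_contra hne
        rcases Nat.lt_or_gt_of_ne hne with h | h
        · exact hr (hrun' _ h)
        · exact hr' (hrun _ h)
      rw [hκ, hκ']
    | left hb' | right hb' | apart d e hb' | bump d r hb' => exact absurd hb hb'
  | left hb hμ hκ h =>
    subst hμ
    exact hκ.trans (h'.eq_of_left_eq hb).symm
  | right hb hν hκ h =>
    subst hν
    exact hκ.trans (h'.symm.eq_of_left_eq hb).symm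
  | apart d e hb hd he hde hμ hν hκ =>
    subst hμ hν
    cases h' with
    | cross r hb' => exact absurd hb' hb
    | left hb' h => exact absurd h hd.move_ne
    | right hb' h => exact absurd h he.move_ne
    | apart d' e' hb' hd' he' hde' hμ' hν' hκ' =>
      obtain rfl := hd.inj hμ'
      obtain rfl := he.inj hν'
      rw [hκ, hκ']
    | bump d' r hb' hd' hμ' hν' => exact absurd (he.inj hν').symm hde
  | bump d r hb hd hμ hν hdr hrun hr hκ =>
    cases h' with
    | cross r hb' => exact absurd hb' hb
    | left hb' h => exact absurd (hμ.symm.trans h) hd.move_ne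
    | right hb' h => exact absurd (hμ.symm.trans (hν.symm.trans h)) hd.move_ne
    | apart d' e' hb' hd' he' hde' hμ' hν' hκ' =>
      exact absurd (hd'.inj (hμ'.symm.trans (hν.symm.trans hν'))) hde'
    | bump d' r' hb' hd' hμ' hν' hdr' hrun' hr' hκ' =>
      obtain rfl := hd.inj (hμ.symm.trans hμ')
      obtain rfl : r = r' := by
        by_contra hne
        rcases Nat.lt_or_gt_of_ne hne with h | h
        · exact hr (hrun' _ (by omega) h)
        · exact hr' (hrun _ (by omega) h)
      rw [hκ, hκ']

lemma Cell.eq_of_right_eq {b : Prop} {ρ μ κ : Finset ℕ} (h : Cell b ρ μ κ κ) :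
    ¬ b ∧ ρ = μ := by
  by_contra hcon
  refine (h.up_right ?_).ne rfl
  tauto

lemma Cell.backward_unique {b b' : Prop} {ρ ρ' μ ν κ : Finset ℕ} (h : Cell b ρ μ ν κ)
    (h' : Cell b' ρ' μ ν κ) : ρ = ρ' ∧ (b ↔ b') := by
  cases h with
  | left hb hμ hκ h =>
    subst hκ
    obtain ⟨h1, h2⟩ := h'.eq_of_right_eq
    exact ⟨hμ.symm.trans h2.symm, by tauto⟩
  | right hb hν hκ h =>
    subst hκ
    obtain ⟨h1, h2⟩ := h'.symm.eq_of_right_eq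
    exact ⟨hν.symm.trans h2.symm, by tauto⟩
  | apart d e hb hd he hde hμ hν hκ =>
    have hne : μ ≠ ν := fun h => hde (hd.inj (hμ.symm.trans (h.trans hν)))
    have h1 := isMove_move he hde
    have h2 := isMove_move hd hde.symm
    have hκ2 := hκ.trans (move_comm hd he)
    rw [← hμ] at h1 hκ
    rw [← hν] at h2 hκ2
    cases h' with
    | cross r hb' hμ' hν' => exact absurd (hμ'.trans hν'.symm) hne
    | left hb' hμ' hκ' => exact absurd (hκ2.symm.trans hκ') h2.move_ne
    | right hb' hμ' hκ' => exact absurd (hκ.symm.trans hκ') h1.move_ne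
    | apart d' e' hb' hd' he' hde' hμ' hν' hκ' =>
      rw [← hμ'] at hκ'
      obtain rfl := h1.inj (hκ.symm.trans hκ')
      refine ⟨he.source_inj he' (hν.symm.trans hν'), by tauto⟩
    | bump d' r hb' hd' hμ' hν' => exact absurd hν'.symm hne
  | cross r hb hμ hν hrun hr hκ =>
    have h1 : IsMove r ρ := ⟨hrun r le_rfl, hr⟩
    subst hμ
    cases h' with
    | cross r' hb' hμ' hν' hrun' hr' hκ' => exact ⟨hμ', by tauto⟩
    | left hb' hμ' hκ' => exact absurd (hκ.symm.trans (hκ'.trans hν)) h1.move_ne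
    | right hb' hμ' hκ' => exact absurd (hκ.symm.trans hκ') h1.move_ne
    | apart d' e' hb' hd' he' hde' hμ' hν' hκ' =>
      exact absurd (hd'.inj (hμ'.symm.trans (hν.symm.trans hν'))) hde'
    | bump d' r' hb' hd' hμ' hν' hdr' hrun' hr' hκ' =>
      obtain rfl := h1.inj (hκ.symm.trans hκ')
      have := hrun d' hdr'.le
      rw [hμ', mem_move] at this
      simp at this
  | bump d r hb hd hμ hν hdr hrun hr hκ =>
    have h1 : IsMove r μ := ⟨hrun r hdr le_rfl, hr⟩
    have h3 : d ∉ μ := by rw [hμ, mem_move]; simp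
    cases h' with
    | cross r' hb' hμ' hν' hrun' hr' hκ' =>
      subst hμ'
      obtain rfl := h1.inj (hκ.symm.trans hκ')
      exact absurd (hrun' d hdr.le) h3
    | left hb' hμ' hκ' => exact absurd (hκ.symm.trans (hκ'.trans hν)) h1.move_ne
    | right hb' hμ' hκ' => exact absurd (hκ.symm.trans hκ') h1.move_ne
    | apart d' e' hb' hd' he' hde' hμ' hν' hκ' =>
      exact absurd (hd'.inj (hμ'.symm.trans (hν.symm.trans hν'))) hde'
    | bump d' r' hb' hd' hμ' hν' hdr' hrun' hr' hκ' =>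
      obtain rfl := h1.inj (hκ.symm.trans hκ')
      have h4 : d' ∉ μ := by rw [hμ', mem_move]; simp
      obtain rfl : d = d' := by
        by_contra hne
        rcases Nat.lt_or_gt_of_ne hne with h | h
        · exact h4 (hrun _ h hdr'.le)
        · exact h3 (hrun' _ h hdr.le)
      exact ⟨hd.source_inj hd' (hμ.symm.trans hμ'), by tauto⟩

/-- `Λ` is a growth diagram on the grid `[0, m] × [0, n]`, with crosses in the cells where `b`
holds, and constant equal to `{0, ..., k - 1}` on the lower and left sides. -/
structure IsGrowth (k m n : ℕ) (b : ℕ → ℕ → Prop) (Λ : ℕ → ℕ → Finset ℕ) : Prop where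
  bottom : ∀ j ≤ n, Λ 0 j = Finset.range k
  left : ∀ i ≤ m, Λ i 0 = Finset.range k
  cell : ∀ i < m, ∀ j < n, Cell (b i j) (Λ i j) (Λ (i + 1) j) (Λ i (j + 1)) (Λ (i + 1) (j + 1))

namespace IsGrowth

variable {k m n : ℕ} {b : ℕ → ℕ → Prop} {Λ : ℕ → ℕ → Finset ℕ}

lemma mono (h : IsGrowth k m n b Λ) {m' n' : ℕ} (hm : m' ≤ m) (hn : n' ≤ n) :
    IsGrowth k m' n' b Λ where
  bottom j hj := h.bottom j (hj.trans hn)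
  left i hi := h.left i (hi.trans hm)
  cell i hi j hj := h.cell i (hi.trans_le hm) j (hj.trans_le hn)

lemma transpose (h : IsGrowth k m n b Λ) :
    IsGrowth k n m (fun i j => b j i) (fun i j => Λ j i) where
  bottom := h.left
  left := h.bottom
  cell i hi j hj := (h.cell j hj i hi).symm

lemma lazyUp (h : IsGrowth k m n b Λ) {i j : ℕ} (hi : i < m) (hj : j ≤ n) :
    LazyUp (Λ i j) (Λ (i + 1) j) := by
  cases j with
  | zero => left; rw [h.left _ hi.le, h.left _ hi]
  | succ j => exact (h.cell i hi j hj).symm.lazyUp_right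

lemma eq_of_no_cross (h : IsGrowth k m n b Λ) {i j : ℕ} (hi : i < m) (hj : j ≤ n)
    (hb : ∀ j' < j, ¬ b i j') : Λ (i + 1) j = Λ i j := by
  induction j with
  | zero => rw [h.left _ hi.le, h.left _ hi]
  | succ j ih =>
    have hc := h.cell i hi j hj
    rw [ih (by omega) fun j' hj' => hb j' (by omega)] at hc
    exact hc.eq_of_left_eq (hb j (by omega))

lemma up_of_cross (h : IsGrowth k m n b Λ) {i j₀ j : ℕ} (hi : i < m) (hj : j ≤ n)
    (hj₀ : j₀ < j) (hb : b i j₀) : Up (Λ i j) (Λ (i + 1) j) := by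
  induction j, Nat.succ_le_of_lt hj₀ using Nat.le_induction with
  | base => exact (h.cell i hi j₀ hj).up_right (.inl hb)
  | succ j hle ih => exact (h.cell i hi j hj).up_right (.inr (ih (by omega) hle).ne)

lemma cross_unique (h : IsGrowth k m n b Λ) {i j j' : ℕ} (hi : i < m) (hj : j < n) (hj' : j' < n)
    (hb : b i j) (hb' : b i j') : j = j' := by
  by_contra hne
  wlog hlt : j < j' generalizing j j'
  · exact this hj' hj hb' hb (Ne.symm hne) (by omega)
  exact (h.up_of_cross hi hj'.le hlt hb).ne ((h.cell i hi j' hj').left_eq hb').symm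

lemma exists_cross (h : IsGrowth k m n b Λ) {i : ℕ} (hi : i < m)
    (hup : Up (Λ i n) (Λ (i + 1) n)) : ∃ j < n, b i j := by
  by_contra! hcon
  exact hup.ne (h.eq_of_no_cross hi le_rfl hcon).symm

/-- Increasing subsequences are not longer than the number of particles that have moved. -/
lemma card_add_le {w : ℕ → ℕ} (hw : w.Injective) (h : IsGrowth k m n (fun i j => w i = j) Λ)
    {i j : ℕ} (hi : i ≤ m) (hj : j ≤ n) {A : Finset ℕ} (hA : A ⊆ Finset.range i)
    (hAj : ∀ a ∈ A, w a < j) (hmono : StrictMonoOn w A) {p : ℕ} (hp : ∀ t < p, t ∈ Λ i j) :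
    A.card + p ≤ k := by
  induction i generalizing j A p with
  | zero =>
    rw [h.bottom j hj] at hp
    obtain rfl : A = ∅ := by simpa using hA
    by_contra! hcon
    simpa using hp k (by simpa using hcon)
  | succ i ihi =>
    induction j generalizing A p with
    | zero =>
      rw [h.left _ hi] at hp
      obtain rfl : A = ∅ := Finset.eq_empty_of_forall_notMem fun a ha => by simpa using hAj a ha
      by_contra! hcon
      simpa using hp k (by simpa using hcon)
    | succ j ihj =>
      have hc := h.cell i hi j hj
      by_cases hb : w i = j
      · have hA' : A.erase i ⊆ Finset.range i := fun a ha => by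
          have := hA (Finset.mem_of_mem_erase ha)
          have := Finset.ne_of_mem_erase ha
          simp at *
          omega
        have hAj' : ∀ a ∈ A.erase i, w a < j := fun a ha => by
          have h1 := hAj a (Finset.mem_of_mem_erase ha)
          have h2 : w a ≠ w i := fun h => Finset.ne_of_mem_erase ha (hw h)
          omega
        have hcard : A.card ≤ (A.erase i).card + 1 := by
          have := Finset.pred_card_le_card_erase (s := A) (a := i)
          omega
        have hp' : ∀ t < p + 1, t ∈ Λ i j := by
          cases hc with
          | cross r _ _ _ hrun hr hκ =>
            rw [hκ] at hp
            have hpr : p ≤ r := by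
              by_contra! hcon
              have := hp r hcon
              simp [mem_move] at this
            exact fun t ht => hrun t (by omega)
          | left hb' | right hb' | apart d e hb' | bump d r hb' => exact absurd hb hb'
        have := ihi (by omega) (by omega) hA' hAj'
          (hmono.mono (Finset.coe_subset.2 (Finset.erase_subset i A))) hp'
        omega
      · have key : ∀ S, LazyUp S (Λ (i + 1) (j + 1)) → ∀ t < p, t ∈ S := by
          rintro S (hS | ⟨d, hd, hS⟩) t ht
          · exact hS ▸ hp t ht
          · rw [hS] at hp
            have h1 : p ≤ d := by
              by_contra! hcon
              have := hp d hcon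
              simp [mem_move] at this
            have := hp t ht
            rw [mem_move] at this
            rcases this with h | h
            · omega
            · exact h.2
        by_cases hiA : i ∈ A
        · refine ihj (by omega) hA (fun a ha => ?_) hmono (key _ hc.lazyUp_right)
          have h1 : a < i + 1 := by simpa using hA ha
          have h2 : w a ≤ w i := hmono.le_iff_le ha hiA |>.2 (by omega)
          have h3 := hAj i hiA
          omega
        · refine ihi (by omega) hj (fun a ha => ?_) hAj hmono (key _ hc.symm.lazyUp_right)
          have h1 : a < i + 1 := by simpa using hA ha
          have h2 : a ≠ i := fun h => hiA (h ▸ ha)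
          simp
          omega

/-- There are increasing subsequences as long as the number of particles that have moved. -/
lemma exists_card_add_ge {w : ℕ → ℕ} (h : IsGrowth k m n (fun i j => w i = j) Λ)
    {i j : ℕ} (hi : i ≤ m) (hj : j ≤ n) {p : ℕ} (hp : p ∉ Λ i j) :
    ∃ A ⊆ Finset.range i, (∀ a ∈ A, w a < j) ∧ StrictMonoOn w A ∧ k ≤ A.card + p := by
  induction i generalizing j p with
  | zero =>
    rw [h.bottom j hj] at hp
    exact ⟨∅, by simp, by simp, by simp [StrictMonoOn], by simpa using hp⟩
  | succ i ihi =>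
    induction j generalizing p with
    | zero =>
      rw [h.left _ hi] at hp
      exact ⟨∅, by simp, by simp, by simp [StrictMonoOn], by simpa using hp⟩
    | succ j ihj =>
      have down : p ∉ Λ i (j + 1) → ∃ A ⊆ Finset.range (i + 1), (∀ a ∈ A, w a < j + 1) ∧
          StrictMonoOn w A ∧ k ≤ A.card + p := fun hp => by
        obtain ⟨A, h1, h2, h3, h4⟩ := ihi (by omega) hj hp
        exact ⟨A, h1.trans (by simp), h2, h3, h4⟩
      have left : ∀ p' ≤ p, p' ∉ Λ (i + 1) j → ∃ A ⊆ Finset.range (i + 1),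
          (∀ a ∈ A, w a < j + 1) ∧ StrictMonoOn w A ∧ k ≤ A.card + p := fun p' hpp hp => by
        obtain ⟨A, h1, h2, h3, h4⟩ := ihj (by omega) hp
        exact ⟨A, h1, fun a ha => (h2 a ha).trans (by omega), h3, by omega⟩
      cases h.cell i hi j hj with
      | cross r hb hμ hν hrun hr hκ =>
        rw [hκ, mem_move] at hp
        by_cases hpr : p = r
        · obtain ⟨A, h1, h2, h3, h4⟩ := ihi (by omega) (by omega) hr
          have hiA : i ∉ A := fun h => by simpa using h1 h
          refine ⟨insert i A, ?_, ?_, ?_, ?_⟩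
          · rw [Finset.range_add_one]
            exact Finset.insert_subset_insert i h1
          · intro a ha
            rcases Finset.mem_insert.1 ha with rfl | ha
            · omega
            · exact (h2 a ha).trans (by omega)
          · have hlt : ∀ a ∈ A, a < i := fun a ha => by simpa using h1 ha
            intro x hx y hy hxy
            simp only [Finset.coe_insert, Set.mem_insert_iff, Finset.mem_coe] at hx hy
            rcases hx with rfl | hx <;> rcases hy with rfl | hy
            · omega
            · have := hlt y hy
              omega
            · exact (h2 x hx).trans_eq hb.symm
            · exact h3 hx hy hxy
          · rw [Finset.card_insert_of_notMem hiA]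
            omega
        · exact down (by rw [hν]; tauto)
      | left _ _ hκ => exact down (hκ ▸ hp)
      | right _ _ hκ => exact left p le_rfl (hκ ▸ hp)
      | apart d e _ hd he hde hμ hν hκ =>
        rw [hκ, mem_move, mem_move] at hp
        by_cases hpe : p = e
        · exact down (by rw [hν, mem_move]; omega)
        · refine left p le_rfl ?_
          rw [hμ, mem_move]
          tauto
      | bump d r _ hd hμ hν hdr hrun hr hκ =>
        rw [hκ, mem_move] at hp
        by_cases hpr : p = r
        · exact left d (by omega) (by rw [hμ, mem_move]; omega)
        · exact left p le_rfl (by tauto)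

lemma forward_unique (h : IsGrowth k m n b Λ) {Λ' : ℕ → ℕ → Finset ℕ} (h' : IsGrowth k m n b Λ')
    {i j : ℕ} (hi : i ≤ m) (hj : j ≤ n) : Λ i j = Λ' i j := by
  induction i generalizing j with
  | zero => rw [h.bottom j hj, h'.bottom j hj]
  | succ i ihi =>
    induction j with
    | zero => rw [h.left _ hi, h'.left _ hi]
    | succ j ihj =>
      have h1 := h.cell i hi j hj
      rw [ihi (by omega) (by omega : j ≤ n), ihi (by omega) hj, ihj (by omega)] at h1
      exact h1.forward_unique (h'.cell i hi j hj)

lemma backward_unique (h : IsGrowth k m n b Λ) {b' : ℕ → ℕ → Prop} {Λ' : ℕ → ℕ → Finset ℕ}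
    (h' : IsGrowth k m n b' Λ') (htop : ∀ j ≤ n, Λ m j = Λ' m j)
    (hright : ∀ i ≤ m, Λ i n = Λ' i n) {i j : ℕ} (hi : i ≤ m) (hj : j ≤ n) :
    Λ i j = Λ' i j := by
  induction hi using Nat.decreasingInduction generalizing j with
  | self => exact htop j hj
  | of_succ i hi ihi =>
    induction hj using Nat.decreasingInduction with
    | self => exact hright i hi.le
    | of_succ j hj ihj =>
      have h1 := h.cell i hi j hj
      rw [ihi hj.le, ihi hj, ihj] at h1
      exact (h1.backward_unique (h'.cell i hi j hj)).1

lemma backward_unique_cross (h : IsGrowth k m n b Λ) {b' : ℕ → ℕ → Prop}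
    {Λ' : ℕ → ℕ → Finset ℕ} (h' : IsGrowth k m n b' Λ') (htop : ∀ j ≤ n, Λ m j = Λ' m j)
    (hright : ∀ i ≤ m, Λ i n = Λ' i n) {i j : ℕ} (hi : i < m) (hj : j < n) :
    b i j ↔ b' i j := by
  have key := fun {i j} => h.backward_unique h' htop hright (i := i) (j := j)
  have h1 := h.cell i hi j hj
  rw [key hi.le hj.le, key hi.le hj, key hi hj.le, key hi hj] at h1
  exact (h1.backward_unique (h'.cell i hi j hj)).2

end IsGrowth

open Classical in
/-- The configurations obtained by applying the local rule from the lower left corner on. -/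
noncomputable def fill (k : ℕ) (b : ℕ → ℕ → Prop) : ℕ → ℕ → Finset ℕ
  | 0, _ => Finset.range k
  | _ + 1, 0 => Finset.range k
  | i + 1, j + 1 =>
    if h : ∃ κ, Cell (b i j) (fill k b i j) (fill k b (i + 1) j) (fill k b i (j + 1)) κ
    then h.choose else ∅

lemma isGrowth_fill {k n : ℕ} {w : ℕ → ℕ} (hw : w.Injective)
    (hlis : ∀ A ⊆ Finset.range n, StrictMonoOn w A → A.card ≤ k) :
    IsGrowth k n n (fun i j => w i = j) (fill k (fun i j => w i = j)) := by
  set b : ℕ → ℕ → Prop := fun i j => w i = j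
  have hbot : ∀ j, fill k b 0 j = Finset.range k := fun j => by rw [fill]
  have hleft : ∀ i, fill k b i 0 = Finset.range k := fun i => by cases i <;> rw [fill]
  suffices hcell : ∀ s i j, i < n → i + j = s → Cell (b i j) (fill k b i j)
      (fill k b (i + 1) j) (fill k b i (j + 1)) (fill k b (i + 1) (j + 1)) from
    ⟨fun j _ => hbot j, fun i _ => hleft i, fun i hi j hj => hcell _ i j hi rfl⟩
  intro s
  induction s using Nat.strong_induction_on with
  | _ s ih =>
    intro i j hi hs
    have h1 : IsGrowth k (i + 1) j b (fill k b) := ⟨fun j _ => hbot j, fun i _ => hleft i,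
      fun i' hi' j' hj' => ih (i' + j') (by omega) i' j' (by omega) rfl⟩
    have h2 : IsGrowth k i (j + 1) b (fill k b) := ⟨fun j _ => hbot j, fun i _ => hleft i,
      fun i' hi' j' hj' => ih (i' + j') (by omega) i' j' (by omega) rfl⟩
    have hex : ∃ κ, Cell (b i j) (fill k b i j) (fill k b (i + 1) j) (fill k b i (j + 1)) κ := by
      refine Cell.exists_forward (h1.lazyUp (by omega) le_rfl)
        (h2.transpose.lazyUp (by omega) le_rfl) fun hb => ⟨?_, ?_, ?_⟩
      · exact h1.eq_of_no_cross (by omega) le_rfl fun j' hj' (h : w i = j') =>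
          hj'.ne (h.symm.trans hb)
      · exact h2.transpose.eq_of_no_cross (by omega) le_rfl fun i' hi' (h : w i' = j) =>
          hi'.ne (hw (h.trans (Eq.symm hb)))
      · by_contra h0
        obtain ⟨A, hA, hAj, hmono, hcard⟩ := h1.exists_card_add_ge (Nat.le_succ i) le_rfl h0
        have hlt : ∀ a ∈ A, a < i := fun a ha => by simpa using hA ha
        have hiA : i ∉ A := fun h => (hlt i h).ne rfl
        have := hlis (insert i A) ?_ ?_
        · rw [Finset.card_insert_of_notMem hiA] at this
          omega
        · intro a ha
          rcases Finset.mem_insert.1 ha with rfl | ha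
          · simpa using hi
          · have := hlt a ha
            simp
            omega
        · intro x hx y hy hxy
          simp only [Finset.coe_insert, Set.mem_insert_iff, Finset.mem_coe] at hx hy
          rcases hx with rfl | hx <;> rcases hy with rfl | hy
          · omega
          · have := hlt y hy
            omega
          · exact (hAj x hx).trans_eq (Eq.symm hb)
          · exact hmono hx hy hxy
    rw [fill.eq_3 k b i j, dif_pos hex]
    exact hex.choose_spec

lemma exists_row_backward {n : ℕ} {T : ℕ → Finset ℕ} (hT : ∀ j < n, LazyUp (T j) (T (j + 1)))
    {Q : Finset ℕ} (hQ : LazyUp Q (T n)) :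
    ∃ (S : ℕ → Finset ℕ) (b : ℕ → Prop), S n = Q ∧
      ∀ j < n, Cell (b j) (S j) (T j) (S (j + 1)) (T (j + 1)) := by
  induction n generalizing Q with
  | zero => exact ⟨fun _ => Q, fun _ => True, rfl, by simp⟩
  | succ n ih =>
    obtain ⟨b₀, ρ, hρ⟩ := Cell.exists_backward (hT n (by omega)) hQ
    obtain ⟨S, b, hS, hcell⟩ := ih (fun j hj => hT j (by omega)) hρ.lazyUp_left
    refine ⟨Function.update S (n + 1) Q, Function.update b n b₀, by simp, fun j hj => ?_⟩
    rcases Nat.lt_succ_iff_lt_or_eq.1 hj with h | rfl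
    · rw [Function.update_of_ne (by omega), Function.update_of_ne (by omega),
        Function.update_of_ne (by omega)]
      exact hcell j h
    · rw [Function.update_self, Function.update_of_ne (by omega), Function.update_self, hS]
      exact hρ

lemma exists_backward {m n : ℕ} {C D : ℕ → Finset ℕ} (hC : ∀ j < n, LazyUp (C j) (C (j + 1)))
    (hD : ∀ i < m, LazyUp (D i) (D (i + 1))) (hCD : D m = C n) :
    ∃ (Λ : ℕ → ℕ → Finset ℕ) (b : ℕ → ℕ → Prop), (∀ j ≤ n, Λ m j = C j) ∧
      (∀ i ≤ m, Λ i n = D i) ∧ ∀ i < m, ∀ j < n,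
        Cell (b i j) (Λ i j) (Λ (i + 1) j) (Λ i (j + 1)) (Λ (i + 1) (j + 1)) := by
  induction m generalizing C with
  | zero =>
    refine ⟨fun _ => C, fun _ _ => True, by simp, fun i hi => ?_, by simp⟩
    obtain rfl : i = 0 := by omega
    exact hCD.symm
  | succ m ih =>
    obtain ⟨S, b₀, hS, hcell⟩ := exists_row_backward hC (hCD ▸ hD m (by omega))
    obtain ⟨Λ, b, h1, h2, h3⟩ := ih (fun j hj => (hcell j hj).symm.lazyUp_left)
      (fun i hi => hD i (by omega)) hS.symm
    refine ⟨Function.update Λ (m + 1) C, Function.update b m b₀, by simp, fun i hi => ?_,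
      fun i hi j hj => ?_⟩
    · rcases Nat.le_succ_iff.1 hi with h | rfl
      · rw [Function.update_of_ne (by omega), h2 i h]
      · rw [Function.update_self, hCD]
    · rcases Nat.lt_succ_iff_lt_or_eq.1 hi with h | rfl
      · rw [Function.update_of_ne (by omega), Function.update_of_ne (by omega),
          Function.update_of_ne (by omega)]
        exact h3 i h j hj
      · rw [Function.update_self, Function.update_of_ne (by omega), Function.update_self,
          h1 j hj.le, h1 (j + 1) hj]
        exact hcell j hj

lemma eq_range_of_lazyUp {k : ℕ} {S : Finset ℕ} (h : LazyUp S (Finset.range k)) :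
    S = Finset.range k := by
  refine h.resolve_right ?_
  rintro ⟨d, hd, h⟩
  have h1 : d + 1 ∈ Finset.range k := by rw [h, mem_move]; simp
  have h2 : d ∉ Finset.range k := by rw [h, mem_move]; simp
  simp at h1 h2
  omega

lemma exists_isGrowth {k n : ℕ} {C D : ℕ → Finset ℕ} (hC0 : C 0 = Finset.range k)
    (hD0 : D 0 = Finset.range k) (hC : ∀ j < n, Up (C j) (C (j + 1)))
    (hD : ∀ i < n, Up (D i) (D (i + 1))) (hCD : D n = C n) :
    ∃ (Λ : ℕ → ℕ → Finset ℕ) (b : ℕ → ℕ → Prop), (∀ j ≤ n, Λ n j = C j) ∧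
      (∀ i ≤ n, Λ i n = D i) ∧ IsGrowth k n n b Λ := by
  obtain ⟨Λ, b, h1, h2, h3⟩ :=
    exists_backward (fun j hj => .inr (hC j hj)) (fun i hi => .inr (hD i hi)) hCD
  rcases Nat.eq_zero_or_pos n with rfl | hn
  · refine ⟨Λ, b, h1, h2, fun j hj => ?_, fun i hi => ?_, by simp⟩
    · obtain rfl : j = 0 := by omega
      rw [h1 0 le_rfl, hC0]
    · obtain rfl : i = 0 := by omega
      rw [h1 0 le_rfl, hC0]
  refine ⟨Λ, b, h1, h2, fun j hj => ?_, fun i hi => ?_, h3⟩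
  · induction hj using Nat.decreasingInduction with
    | self => rw [h2 0 (by omega), hD0]
    | of_succ j hj ih =>
      have := (h3 0 hn j hj).symm.lazyUp_left
      rw [ih] at this
      exact eq_range_of_lazyUp this
  · induction hi using Nat.decreasingInduction with
    | self => rw [h1 0 (by omega), hC0]
    | of_succ i hi ih =>
      have := (h3 i hi 0 hn).lazyUp_left
      rw [ih] at this
      exact eq_range_of_lazyUp this

open Classical in
/-- The sequences of configurations which start with `{0, ..., k - 1}`, make `n` jumps to the
right, and then stay at `S` forever. -/
noncomputable def chains (k : ℕ) : ℕ → Finset ℕ → Finset (ℕ → Finset ℕ)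
  | 0, S => if S = Finset.range k then {fun _ => Finset.range k} else ∅
  | n + 1, S => {e ∈ S | 1 ≤ e ∧ e - 1 ∉ S}.biUnion fun e =>
      (chains k n (moveBack (e - 1) S)).image fun c i => if i ≤ n then c i else S

lemma mem_chains {k n : ℕ} {S : Finset ℕ} {c : ℕ → Finset ℕ} :
    c ∈ chains k n S ↔
      c 0 = Finset.range k ∧ (∀ i < n, Up (c i) (c (i + 1))) ∧ ∀ i, n ≤ i → c i = S := by
  induction n generalizing S c with
  | zero =>
    rw [chains]
    split_ifs with h
    · subst h
      simp only [Finset.mem_singleton]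
      exact ⟨fun h => by simp [h], fun h => funext fun i => h.2.2 i (Nat.zero_le i)⟩
    · simp only [Finset.notMem_empty, false_iff]
      exact fun h' => h ((h'.2.2 0 le_rfl).symm.trans h'.1)
  | succ n ih =>
    simp only [chains, Finset.mem_biUnion, Finset.mem_filter, Finset.mem_image, ih]
    constructor
    · rintro ⟨e, ⟨heS, he1, he⟩, c, ⟨h0, hup, hend⟩, rfl⟩
      refine ⟨by simpa using h0, fun i hi => ?_, fun i hi => if_neg (by omega)⟩
      rcases Nat.lt_succ_iff_lt_or_eq.1 hi with h | rfl
      · simpa [h.le, Nat.succ_le_of_lt h] using hup i h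
      · simp only [le_refl, if_true, Nat.not_succ_le_self, if_false, hend i le_rfl]
        have := up_of_isMove (isMove_moveBack (d := e - 1) (S := S))
        rwa [move_moveBack he (by rwa [Nat.sub_add_cancel he1])] at this
    · rintro ⟨h0, hup, hend⟩
      obtain ⟨d, hd, hS⟩ := hup n (by omega)
      rw [hend _ le_rfl] at hS
      have h1 : d ∉ S := by rw [hS, mem_move]; simp
      have h2 : d + 1 ∈ S := by rw [hS, mem_move]; simp
      refine ⟨d + 1, ⟨h2, by omega, by simpa using h1⟩, fun i => c (min i n),
        ⟨by simpa using h0, fun i hi => ?_, fun i hi => ?_⟩, ?_⟩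
      · simpa [hi.le, Nat.succ_le_of_lt hi] using hup i (by omega)
      · simp only [min_eq_right hi]
        exact hd.source_inj isMove_moveBack (hS.symm.trans (move_moveBack h1 h2).symm)
      · funext i
        split_ifs with h
        · simp [h]
        · exact (hend i (by omega)).symm

lemma card_chains_zero {k : ℕ} {S : Finset ℕ} :
    (chains k 0 S).card = if S = Finset.range k then 1 else 0 := by
  rw [chains]
  split_ifs <;> simp

lemma card_chains_succ {k n : ℕ} {S : Finset ℕ} :
    (chains k (n + 1) S).card =
      ∑ e ∈ S with 1 ≤ e ∧ e - 1 ∉ S, (chains k n (moveBack (e - 1) S)).card := by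
  classical
  rw [chains, Finset.card_biUnion]
  · refine Finset.sum_congr rfl fun e _ => Finset.card_image_of_injOn fun c hc c' hc' h => ?_
    funext i
    have hc := (mem_chains.1 hc).2.2
    have hc' := (mem_chains.1 hc').2.2
    rcases le_total i n with hi | hi
    · simpa [hi] using congrFun h i
    · rw [hc i hi, hc' i hi]
  · intro e he e' he' hne
    rw [Function.onFun, Finset.disjoint_left]
    intro c hc hc'
    simp only [Finset.mem_image, mem_chains] at hc hc'
    obtain ⟨c₁, ⟨-, -, h₁⟩, rfl⟩ := hc
    obtain ⟨c₂, ⟨-, -, h₂⟩, h⟩ := hc'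
    have h := congrFun h n
    simp only [le_refl, if_true, h₁, h₂] at h
    simp only [Finset.coe_filter, Set.mem_ofPred_eq] at he he'
    have h3 : e - 1 ∈ moveBack (e' - 1) S := h ▸ (isMove_moveBack (S := S)).1
    have h4 : e' - 1 ∈ moveBack (e - 1) S := h ▸ (isMove_moveBack (S := S)).1
    simp only [moveBack, Finset.mem_insert, Finset.mem_erase] at h3 h4
    have := he.2.2
    have := he.2.1
    have := he'.2.1
    rcases h3 with h3 | h3
    · omega
    · exact he.2.2 h3.2

lemma card_move {d : ℕ} {S : Finset ℕ} (h : IsMove d S) : (move d S).card = S.card := by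
  rw [move, Finset.card_insert_of_notMem (fun h' => h.2 (Finset.mem_of_mem_erase h')),
    Finset.card_erase_add_one h.1]

lemma mem_powersetCard_of_mem_chains {k n : ℕ} {S : Finset ℕ} {c : ℕ → Finset ℕ}
    (h : c ∈ chains k n S) {N : ℕ} (hN : n + k ≤ N) :
    S ∈ Finset.powersetCard k (Finset.range N) := by
  obtain ⟨h0, hup, hend⟩ := mem_chains.1 h
  have key : ∀ i ≤ n, (∀ t ∈ c i, t < i + k) ∧ (c i).card = k := by
    intro i hi
    induction i with
    | zero => rw [h0]; simp
    | succ i ih =>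
      obtain ⟨h1, h2⟩ := ih (by omega)
      obtain ⟨d, hd, h⟩ := hup i hi
      rw [h, card_move hd]
      refine ⟨fun t ht => ?_, h2⟩
      rcases mem_move.1 ht with rfl | ht
      · have := h1 d hd.1
        omega
      · have := h1 t ht.2
        omega
  have := key n le_rfl
  rw [hend n le_rfl] at this
  exact Finset.mem_powersetCard.2 ⟨fun t ht => Finset.mem_range.2 ((this.1 t ht).trans_le hN), this.2⟩

/-- The extension of a permutation of `Fin n` to a function on `ℕ` by the identity. -/
def extend {n : ℕ} (w : Equiv.Perm (Fin n)) (a : ℕ) : ℕ := if h : a < n then w ⟨a, h⟩ else a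

lemma extend_of_lt {n : ℕ} (w : Equiv.Perm (Fin n)) {a : ℕ} (h : a < n) :
    extend w a = w ⟨a, h⟩ := dif_pos h

lemma extend_lt {n : ℕ} (w : Equiv.Perm (Fin n)) {a : ℕ} (h : a < n) : extend w a < n := by
  rw [extend_of_lt w h]
  exact (w _).2

lemma extend_injective {n : ℕ} (w : Equiv.Perm (Fin n)) : (extend w).Injective := by
  intro a a' h
  unfold extend at h
  split_ifs at h with h1 h2 h2
  · simpa using w.injective (Fin.ext h)
  · have := (w ⟨a, h1⟩).2
    omega
  · have := (w ⟨a', h2⟩).2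
    omega
  · exact h

lemma card_le_iff {k n : ℕ} (w : Equiv.Perm (Fin n)) :
    (¬ ∃ s : Fin (k + 1) → Fin n, StrictMono s ∧ StrictMono (w ∘ s)) ↔
      ∀ A ⊆ Finset.range n, StrictMonoOn (extend w) A → A.card ≤ k := by
  rw [not_iff_comm]
  push Not
  constructor
  · rintro ⟨A, hA, hmono, hcard⟩
    obtain ⟨A', hA', hcard'⟩ := Finset.exists_subset_card_eq (Nat.succ_le_of_lt hcard)
    have hlt : ∀ i, A'.orderEmbOfFin hcard' i < n := fun i =>
      Finset.mem_range.1 (hA (hA' (A'.orderEmbOfFin_mem hcard' i)))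
    refine ⟨fun i => ⟨A'.orderEmbOfFin hcard' i, hlt i⟩, fun i j hij => ?_, fun i j hij => ?_⟩
    · exact (A'.orderEmbOfFin hcard').strictMono hij
    · have := hmono (hA' (A'.orderEmbOfFin_mem hcard' i)) (hA' (A'.orderEmbOfFin_mem hcard' j))
        ((A'.orderEmbOfFin hcard').strictMono hij)
      rwa [extend_of_lt w (hlt i), extend_of_lt w (hlt j)] at this
  · rintro ⟨s, hs, hws⟩
    refine ⟨Finset.univ.image fun i => (s i : ℕ), fun a ha => ?_, ?_, ?_⟩
    · obtain ⟨i, -, rfl⟩ := Finset.mem_image.1 ha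
      simp
    · intro a ha a' ha' hlt
      simp only [Finset.coe_image, Finset.coe_univ, Set.image_univ, Set.mem_range] at ha ha'
      obtain ⟨i, rfl⟩ := ha
      obtain ⟨j, rfl⟩ := ha'
      rw [extend_of_lt w (s i).2, extend_of_lt w (s j).2]
      exact hws (hs.lt_iff_lt.1 hlt)
    · have := Finset.card_image_of_injective Finset.univ (Fin.val_injective.comp hs.injective)
      simp_all [Function.comp_def]

lemma isGrowth_fill_extend {k n : ℕ} {w : Equiv.Perm (Fin n)}
    (hw : ¬ ∃ s : Fin (k + 1) → Fin n, StrictMono s ∧ StrictMono (w ∘ s)) :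
    IsGrowth k n n (fun i j => extend w i = j) (fill k fun i j => extend w i = j) :=
  isGrowth_fill (extend_injective w) ((card_le_iff w).1 hw)

lemma IsGrowth.right_mem_chains {k n : ℕ} {b : ℕ → ℕ → Prop} {Λ : ℕ → ℕ → Finset ℕ}
    (h : IsGrowth k n n b Λ) (hb : ∀ i < n, ∃ j < n, b i j) :
    (fun i => Λ (min i n) n) ∈ chains k n (Λ n n) := by
  refine mem_chains.2 ⟨?_, fun i hi => ?_, fun i hi => by rw [min_eq_right hi]⟩
  · rw [min_eq_left (Nat.zero_le n), h.bottom n le_rfl]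
  · obtain ⟨j, hj, hij⟩ := hb i hi
    simp only [min_eq_left hi.le, min_eq_left (Nat.succ_le_of_lt hi)]
    exact h.up_of_cross hi le_rfl hj hij

lemma exists_perm {n : ℕ} {b : ℕ → ℕ → Prop} (h1 : ∀ i < n, ∃ j < n, b i j)
    (h2 : ∀ i < n, ∀ j < n, ∀ j' < n, b i j → b i j' → j = j')
    (h3 : ∀ j < n, ∀ i < n, ∀ i' < n, b i j → b i' j → i = i') :
    ∃ w : Equiv.Perm (Fin n), ∀ i < n, ∀ j < n, b i j ↔ extend w i = j := by
  choose! f hf hb using h1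
  let g : Fin n → Fin n := fun i => ⟨f i, hf i i.2⟩
  have hg : g.Injective := fun i i' h => by
    have h : f i = f i' := by simpa [g] using h
    exact Fin.ext (h3 (f i) (hf i i.2) i i.2 i' i'.2 (hb i i.2) (h ▸ hb i' i'.2))
  refine ⟨Equiv.ofBijective g (Finite.injective_iff_bijective.1 hg), fun i hi j hj => ?_⟩
  rw [extend_of_lt _ hi]
  change b i j ↔ f i = j
  exact ⟨fun h => h2 i hi _ (hf i hi) j hj (hb i hi) h, fun h => h ▸ hb i hi⟩

lemma IsGrowth.congr {k m n : ℕ} {b b' : ℕ → ℕ → Prop} {Λ : ℕ → ℕ → Finset ℕ}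
    (h : IsGrowth k m n b Λ) (hb : ∀ i < m, ∀ j < n, b i j ↔ b' i j) : IsGrowth k m n b' Λ where
  bottom := h.bottom
  left := h.left
  cell i hi j hj := propext (hb i hi j hj) ▸ h.cell i hi j hj

/-- The Robinson–Schensted correspondence for permutations without long increasing subsequences. -/
theorem u_eq_sum_sq {k n N : ℕ} (hN : n + k ≤ N) :
    u k n = ∑ S ∈ Finset.powersetCard k (Finset.range N), (chains k n S).card ^ 2 := by
  classical
  set P := (Finset.powersetCard k (Finset.range N)).biUnion fun S =>
    chains k n S ×ˢ chains k n S with hP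
  have hmemP : ∀ p, p ∈ P ↔ ∃ S, p.1 ∈ chains k n S ∧ p.2 ∈ chains k n S := by
    intro p
    simp only [hP, Finset.mem_biUnion, Finset.mem_product]
    exact ⟨fun ⟨S, _, h⟩ => ⟨S, h⟩, fun ⟨S, h⟩ => ⟨S, mem_powersetCard_of_mem_chains h.1 hN, h⟩⟩
  have hcard : P.card =
      ∑ S ∈ Finset.powersetCard k (Finset.range N), (chains k n S).card ^ 2 := by
    rw [hP, Finset.card_biUnion]
    · simp [sq]
    · intro S _ T _ hST
      rw [Function.onFun, Finset.disjoint_left]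
      intro p hp hp'
      have h1 := (mem_chains.1 (Finset.mem_product.1 hp).1).2.2 n le_rfl
      have h2 := (mem_chains.1 (Finset.mem_product.1 hp').1).2.2 n le_rfl
      exact hST (h1.symm.trans h2)
  rw [← hcard, ← Nat.card_eq_finsetCard, u]
  let Φ : Equiv.Perm (Fin n) → ℕ → ℕ → Finset ℕ := fun w => fill k fun i j => extend w i = j
  have hΦ : ∀ w : {w : Equiv.Perm (Fin n) //
      ¬ ∃ s : Fin (k + 1) → Fin n, StrictMono s ∧ StrictMono (w ∘ s)},
      IsGrowth k n n (fun i j => extend w.1 i = j) (Φ w.1) := fun w => isGrowth_fill_extend w.2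
  have hmem : ∀ w : {w : Equiv.Perm (Fin n) //
      ¬ ∃ s : Fin (k + 1) → Fin n, StrictMono s ∧ StrictMono (w ∘ s)},
      ((fun i => Φ w.1 (min i n) n, fun j => Φ w.1 n (min j n)) :
        (ℕ → Finset ℕ) × (ℕ → Finset ℕ)) ∈ P := fun w => by
    refine (hmemP _).2 ⟨Φ w.1 n n, (hΦ w).right_mem_chains fun i hi => ?_,
      (hΦ w).transpose.right_mem_chains fun j hj => ?_⟩
    · exact ⟨_, extend_lt w.1 hi, rfl⟩
    · refine ⟨w.1.symm ⟨j, hj⟩, (w.1.symm ⟨j, hj⟩).2, ?_⟩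
      rw [extend_of_lt w.1 (w.1.symm ⟨j, hj⟩).2]
      simp
  refine Nat.card_congr (Equiv.ofBijective (fun w => ⟨_, hmem w⟩) ⟨fun w w' h => ?_, ?_⟩)
  · simp only [Subtype.mk.injEq, Prod.mk.injEq] at h
    obtain ⟨hr, ht⟩ := h
    ext i
    have key := (hΦ w).backward_unique_cross (hΦ w') (fun j hj => ?_) (fun i hi => ?_) i.2
      (extend_lt w.1 i.2)
    · have := key.1 rfl
      rw [extend_of_lt w.1 i.2, extend_of_lt w'.1 i.2] at this
      exact this.symm
    · simpa [hj] using congrFun ht j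
    · simpa [hi] using congrFun hr i
  · rintro ⟨⟨D, C⟩, hDC⟩
    obtain ⟨S, hD, hC⟩ := (hmemP _).1 hDC
    simp only [mem_chains] at hD hC
    obtain ⟨hD0, hDup, hDend⟩ := hD
    obtain ⟨hC0, hCup, hCend⟩ := hC
    obtain ⟨Λ, b, htop, hright, hg⟩ := exists_isGrowth hC0 hD0 hCup hDup
      ((hDend n le_rfl).trans (hCend n le_rfl).symm)
    obtain ⟨w, hw⟩ := exists_perm
      (fun i hi => hg.exists_cross hi (by
        rw [hright i hi.le, hright (i + 1) hi]; exact hDup i hi))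
      (fun i hi j hj j' hj' => hg.cross_unique hi hj hj')
      (fun j hj i hi i' hi' => hg.transpose.cross_unique hj hi hi')
    have hg' := hg.congr hw
    have hlis : ∀ A ⊆ Finset.range n, StrictMonoOn (extend w) A → A.card ≤ k := by
      intro A hA hmono
      exact hg'.card_add_le (p := 0) (extend_injective w) le_rfl le_rfl hA
        (fun a ha => extend_lt w (Finset.mem_range.1 (hA ha))) hmono (by simp)
    have hlis' := (card_le_iff w).2 hlis
    have heq := fun {i j} => (hΦ ⟨w, hlis'⟩).forward_unique hg' (i := i) (j := j)
    refine ⟨⟨w, hlis'⟩, Subtype.ext (Prod.ext (funext fun i => ?_) (funext fun j => ?_))⟩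
    · change Φ w (min i n) n = D i
      rw [heq (min_le_right i n) le_rfl, hright _ (min_le_right i n)]
      rcases le_total i n with h | h
      · rw [min_eq_left h]
      · rw [min_eq_right h, hDend i h, hDend n le_rfl]
    · change Φ w n (min j n) = C j
      rw [heq le_rfl (min_le_right j n), htop _ (min_le_right j n)]
      rcases le_total j n with h | h
      · rw [min_eq_left h]
      · rw [min_eq_right h, hCend j h, hCend n le_rfl]

lemma sum_eq_of_mem_chains {k n : ℕ} {S : Finset ℕ} {c : ℕ → Finset ℕ} (h : c ∈ chains k n S) :
    ∑ t ∈ S, t = n + ∑ j : Fin k, (j : ℕ) := by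
  obtain ⟨h0, hup, hend⟩ := mem_chains.1 h
  have key : ∀ i ≤ n, ∑ t ∈ c i, t = i + ∑ j : Fin k, (j : ℕ) := by
    intro i hi
    induction i with
    | zero => rw [h0, Finset.sum_range, zero_add]
    | succ i ih =>
      obtain ⟨d, hd, h⟩ := hup i hi
      have h1 := ih (by omega)
      rw [← Finset.add_sum_erase _ _ hd.1] at h1
      rw [h, move, Finset.sum_insert fun h' => hd.2 (Finset.mem_of_mem_erase h')]
      omega
  rw [← key n le_rfl, hend n le_rfl]

/-- The reciprocal of the factorial of an integer, which vanishes at negative integers. -/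
def invFact (m : ℤ) : ℚ := if 0 ≤ m then 1 / (m.toNat.factorial : ℚ) else 0

lemma invFact_of_neg {m : ℤ} (h : m < 0) : invFact m = 0 := if_neg (by omega)

lemma invFact_natCast (m : ℕ) : invFact m = 1 / (m.factorial : ℚ) := by simp [invFact]

lemma mul_invFact (m : ℤ) : (m : ℚ) * invFact m = invFact (m - 1) := by
  rcases lt_or_ge m 0 with h | h
  · rw [invFact_of_neg h, invFact_of_neg (by omega), mul_zero]
  lift m to ℕ using h
  cases m with
  | zero => simp [invFact_of_neg]
  | succ m =>
    have h1 : ((m + 1 : ℕ) : ℤ) - 1 = (m : ℕ) := by push_cast; ring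
    rw [h1, invFact_natCast, invFact_natCast, Nat.factorial_succ]
    have : (m.factorial : ℚ) ≠ 0 := by positivity
    push_cast
    field_simp

/-- The determinant with rows indexed by the integers `l i`, and entries `1 / (l i - j)!`. -/
def minor {k : ℕ} (l : Fin k → ℤ) : ℚ :=
  Matrix.det (Matrix.of fun i j : Fin k => invFact (l i - (j : ℕ)))

lemma minor_eq_sum {k : ℕ} (l : Fin k → ℤ) :
    minor l = ∑ σ : Equiv.Perm (Fin k),
      (Equiv.Perm.sign σ : ℚ) * ∏ i, invFact (l i - (σ i : ℕ)) := by
  rw [minor, ← Matrix.det_transpose, Matrix.det_apply']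
  simp

lemma sum_mul_minor {k : ℕ} (l : Fin k → ℤ) :
    (((∑ i, l i) - ∑ j : Fin k, ((j : ℕ) : ℤ) : ℤ) : ℚ) * minor l =
      ∑ i, minor (Function.update l i (l i - 1)) := by
  simp only [minor_eq_sum]
  rw [Finset.sum_comm, Finset.mul_sum]
  refine Finset.sum_congr rfl fun σ _ => ?_
  rw [← Finset.mul_sum, mul_left_comm]
  congr 1
  rw [← Equiv.sum_comp σ fun j : Fin k => ((j : ℕ) : ℤ), ← Finset.sum_sub_distrib, Int.cast_sum,
    Finset.sum_mul]
  refine Finset.sum_congr rfl fun i _ => ?_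
  rw [← Finset.mul_prod_erase _ _ (Finset.mem_univ i), ← mul_assoc, mul_invFact,
    ← Finset.mul_prod_erase _ (fun i' => invFact (Function.update l i (l i - 1) i' - _))
      (Finset.mem_univ i), Function.update_self]
  congr 1
  · congr 1; ring
  · refine Finset.prod_congr rfl fun i' hi' => ?_
    rw [Function.update_of_ne (Finset.ne_of_mem_erase hi')]

lemma minor_eq_zero_of_eq {k : ℕ} {l : Fin k → ℤ} {i j : Fin k} (hij : i ≠ j) (h : l i = l j) :
    minor l = 0 :=
  Matrix.det_zero_of_row_eq hij (funext fun _ => by simp [h])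

lemma minor_eq_zero_of_neg {k : ℕ} {l : Fin k → ℤ} {i : Fin k} (h : l i < 0) : minor l = 0 :=
  Matrix.det_eq_zero_of_row_eq_zero i fun j => invFact_of_neg (by omega)

lemma minor_val (k : ℕ) : minor (fun i : Fin k => ((i : ℕ) : ℤ)) = 1 := by
  rw [minor, Matrix.det_of_isLowerTriangular]
  · simp [invFact]
  · intro i j hij
    have : i < j := hij
    exact invFact_of_neg (by have : (i : ℕ) < j := this; omega)

lemma val_le_of_strictMono {k : ℕ} {e : Fin k → ℕ} (he : StrictMono e) (i : Fin k) :
    (i : ℕ) ≤ e i := by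
  obtain ⟨i, hi⟩ := i
  induction i with
  | zero => simp
  | succ i ih =>
    have h1 := ih (by omega)
    have h2 : e ⟨i, by omega⟩ < e ⟨i + 1, hi⟩ := he (Fin.mk_lt_mk.2 (by omega))
    simp only at *
    omega

/-- The determinant formula for the number of chains of configurations. -/
lemma card_chains_eq {k n : ℕ} {e : Fin k → ℕ} (he : StrictMono e)
    (hsum : ∑ i, e i = n + ∑ j : Fin k, (j : ℕ)) :
    ((chains k n (Finset.univ.image e)).card : ℚ) =
      n.factorial * minor fun i => ((e i : ℕ) : ℤ) := by
  induction n generalizing e with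
  | zero =>
    have h1 : ∀ i : Fin k, (i : ℕ) = e i := by
      rw [zero_add] at hsum
      have := (Finset.sum_eq_sum_iff_of_le fun i _ => val_le_of_strictMono he i).1 hsum.symm
      simpa using this
    obtain rfl : e = fun i : Fin k => (i : ℕ) := funext fun i => (h1 i).symm
    rw [card_chains_zero, if_pos, minor_val]
    · simp
    · ext t
      simp only [Finset.mem_image, Finset.mem_univ, true_and, Finset.mem_range]
      exact ⟨fun ⟨i, hi⟩ => hi ▸ i.2, fun h => ⟨⟨t, h⟩, rfl⟩⟩
  | succ n ih =>
    have h1 := sum_mul_minor fun i => ((e i : ℕ) : ℤ)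
    have h2 : ((∑ i, ((e i : ℕ) : ℤ)) - ∑ j : Fin k, ((j : ℕ) : ℤ) : ℤ) = n + 1 := by
      rw [← Nat.cast_sum, ← Nat.cast_sum, hsum]
      push_cast
      ring
    rw [h2] at h1
    push_cast at h1
    rw [Nat.factorial_succ, Nat.cast_mul, mul_comm ((n + 1 : ℕ) : ℚ), mul_assoc]
    push_cast
    rw [h1, card_chains_succ, Finset.sum_filter, Finset.sum_image he.injective.injOn, Nat.cast_sum,
      Finset.mul_sum]
    refine Finset.sum_congr rfl fun i _ => ?_
    split_ifs with hcond
    · obtain ⟨hi1, hi⟩ := hcond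
      have hne : ∀ i', e i' ≠ e i - 1 := fun i' h => hi (h ▸ Finset.mem_image_of_mem e (by simp))
      have hmono : StrictMono (Function.update e i (e i - 1)) := by
        intro a a' haa'
        have := he haa'
        have := hne a
        have := hne a'
        simp only [Function.update_apply]
        split_ifs with h1 h2 h2 <;> subst_vars <;> omega
      have himage : moveBack (e i - 1) (Finset.univ.image e) =
          Finset.univ.image (Function.update e i (e i - 1)) := by
        ext t
        simp only [moveBack, Nat.sub_add_cancel hi1, Finset.mem_insert, Finset.mem_erase,
          Finset.mem_image, Finset.mem_univ, true_and]
        constructor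
        · rintro (rfl | ⟨hne, a, rfl⟩)
          · exact ⟨i, by simp⟩
          · exact ⟨a, Function.update_of_ne (fun h => hne (congrArg e h)) _ _⟩
        · rintro ⟨a, rfl⟩
          rcases eq_or_ne a i with rfl | ha
          · simp
          · rw [Function.update_of_ne ha]
            exact .inr ⟨fun h => ha (he.injective h), a, rfl⟩
      have hsum' : ∑ a, Function.update e i (e i - 1) a = n + ∑ j : Fin k, (j : ℕ) := by
        rw [Finset.sum_update_of_mem (Finset.mem_univ i)]
        rw [← Finset.add_sum_erase _ _ (Finset.mem_univ i)] at hsum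
        rw [Finset.sdiff_singleton_eq_erase]
        omega
      rw [himage, ih hmono hsum']
      congr 2
      funext a
      rcases eq_or_ne a i with rfl | ha
      · rw [Function.update_self, Function.update_self]; omega
      · rw [Function.update_of_ne ha, Function.update_of_ne ha]
    · rw [Nat.cast_zero, eq_comm]
      refine mul_eq_zero_of_right _ ?_
      rw [not_and_or, not_not] at hcond
      rcases hcond with h | h
      · refine minor_eq_zero_of_neg (i := i) ?_
        rw [Function.update_self]
        omega
      · rw [Finset.mem_image] at h
        obtain ⟨a, -, ha⟩ := h
        rcases Nat.eq_zero_or_pos (e i) with h0 | h0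
        · refine minor_eq_zero_of_neg (i := i) ?_
          rw [Function.update_self]
          omega
        · have hai : a ≠ i := fun h => by subst h; omega
          refine minor_eq_zero_of_eq hai ?_
          rw [Function.update_of_ne hai, Function.update_self]
          omega

section CauchyBinet

variable {R : Type*} [CommRing R]

lemma det_mul_eq_sum {ι κ : Type*} [Fintype ι] [DecidableEq ι] [Fintype κ]
    (M : Matrix ι κ R) (B : Matrix κ ι R) :
    (M * B).det = ∑ f : ι → κ, (∏ i, M i (f i)) * (B.submatrix f id).det := by
  classical
  have h : M * B = fun i => ∑ a, M i a • B a := by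
    funext i
    funext j
    simp [Matrix.mul_apply]
  rw [h]
  change Matrix.detRowAlternating _ = _
  rw [← AlternatingMap.coe_multilinearMap, MultilinearMap.map_sum]
  refine Finset.sum_congr rfl fun f _ => ?_
  rw [MultilinearMap.map_smul_univ]
  rfl

/-- The Cauchy–Binet formula. -/
theorem det_mul_eq_sum_orderEmbedding {k N : ℕ} (M : Matrix (Fin k) (Fin N) R)
    (B : Matrix (Fin N) (Fin k) R) :
    (M * B).det = ∑ e : Fin k ↪o Fin N, (M.submatrix id e).det * (B.submatrix e id).det := by
  classical
  rw [det_mul_eq_sum]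
  have h1 : ∀ e : Fin k ↪o Fin N, (M.submatrix id e).det * (B.submatrix e id).det =
      ∑ σ : Equiv.Perm (Fin k), (∏ i, M i (e (σ i))) * (B.submatrix (e ∘ σ) id).det := by
    intro e
    rw [← Matrix.det_transpose, Matrix.det_apply', Finset.sum_mul]
    refine Finset.sum_congr rfl fun σ _ => ?_
    have : B.submatrix (e ∘ σ) id = (B.submatrix e id).submatrix σ id := rfl
    rw [this, Matrix.det_permute]
    simp only [Matrix.transpose_apply, Matrix.submatrix_apply, id]
    ring
  simp only [h1]
  rw [← Finset.sum_product', Finset.univ_product_univ]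
  symm
  refine Finset.sum_of_injOn (fun p : (Fin k ↪o Fin N) × Equiv.Perm (Fin k) => p.1 ∘ p.2) ?_
    (by simp) ?_ (fun _ _ => rfl)
  · rintro ⟨e, σ⟩ _ ⟨e', σ'⟩ _ h
    have h : e ∘ σ = e' ∘ σ' := h
    have hr : Set.range e = Set.range e' := by
      rw [← σ.surjective.range_comp e, h, σ'.surjective.range_comp]
    obtain rfl : e = e' := DFunLike.coe_injective ((e.strictMono.range_inj e'.strictMono).1 hr)
    obtain rfl : σ = σ' := Equiv.ext fun i => e.injective (congrFun h i)
    rfl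
  · intro f _ hf
    by_cases hinj : f.Injective
    · refine absurd ⟨(OrderEmbedding.ofStrictMono (f ∘ Tuple.sort f) ?_, (Tuple.sort f)⁻¹),
        by simp, ?_⟩ hf
      · exact (Tuple.monotone_sort f).strictMono_of_injective
          (hinj.comp (Tuple.sort f).injective)
      · funext i
        simp
    · simp only [Function.Injective, not_forall] at hinj
      obtain ⟨i, j, hij, hne⟩ := hinj
      rw [Matrix.det_zero_of_row_eq hne (funext fun a => by simp [hij]), mul_zero]

end CauchyBinet

lemma sum_powersetCard_eq {M : Type*} [AddCommMonoid M] (k N : ℕ) (F : Finset ℕ → M) :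
    ∑ S ∈ Finset.powersetCard k (Finset.range N), F S =
      ∑ e : Fin k ↪o Fin N, F (Finset.univ.image fun i => (e i : ℕ)) := by
  symm
  refine Finset.sum_bij (fun e _ => Finset.univ.image fun i => (e i : ℕ)) ?_ ?_ ?_
    (fun _ _ => rfl)
  · intro e _
    refine Finset.mem_powersetCard.2 ⟨fun t ht => ?_, ?_⟩
    · obtain ⟨i, -, rfl⟩ := Finset.mem_image.1 ht
      simp
    · rw [Finset.card_image_of_injective _ fun i j h => e.injective (Fin.ext h)]
      simp
  · intro e _ e' _ h
    have h1 : StrictMono fun i => (e i : ℕ) := fun i j hij => e.strictMono hij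
    have h2 : StrictMono fun i => (e' i : ℕ) := fun i j hij => e'.strictMono hij
    have h := congrArg (fun S : Finset ℕ => (S : Set ℕ)) h
    simp only [Finset.coe_image, Finset.coe_univ, Set.image_univ] at h
    have := (h1.range_inj h2).1 h
    ext i
    exact congrFun this i
  · intro S hS
    obtain ⟨hS, hcard⟩ := Finset.mem_powersetCard.1 hS
    have hlt : ∀ i, S.orderEmbOfFin hcard i < N := fun i =>
      Finset.mem_range.1 (hS (S.orderEmbOfFin_mem hcard i))
    refine ⟨OrderEmbedding.ofStrictMono (fun i => ⟨S.orderEmbOfFin hcard i, hlt i⟩)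
      fun i j hij => (S.orderEmbOfFin hcard).strictMono hij, Finset.mem_univ _, ?_⟩
    apply Finset.coe_injective
    rw [Finset.coe_image, Finset.coe_univ, Set.image_univ]
    exact Finset.range_orderEmbOfFin S hcard

open PowerSeries in
/-- The power series version of the matrix with entries `1 / (a - i)!`. -/
noncomputable def expMatrix (k N : ℕ) : Matrix (Fin N) (Fin k) (PowerSeries ℚ) :=
  Matrix.of fun a i => C (invFact ((a : ℕ) - (i : ℕ))) * X ^ ((a : ℕ) - (i : ℕ))

open PowerSeries in
lemma det_submatrix_expMatrix {k N : ℕ} (e : Fin k → Fin N) :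
    ((expMatrix k N).submatrix e id).det =
      C (minor fun i => ((e i : ℕ) : ℤ)) * X ^ (∑ i, (e i : ℕ) - ∑ j : Fin k, (j : ℕ)) := by
  rw [← Matrix.det_transpose, Matrix.det_apply', minor_eq_sum, map_sum, Finset.sum_mul]
  refine Finset.sum_congr rfl fun σ _ => ?_
  simp only [Matrix.transpose_apply, Matrix.submatrix_apply, id, expMatrix, Matrix.of_apply]
  rw [Finset.prod_mul_distrib, Finset.prod_pow_eq_pow_sum, ← map_prod, map_mul, map_intCast,
    mul_assoc]
  by_cases h : ∀ i, (σ i : ℕ) ≤ e i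
  · rw [← Equiv.sum_comp σ fun j : Fin k => (j : ℕ), ← Finset.sum_tsub_distrib _ fun i _ => h i]
  · push Not at h
    obtain ⟨i, hi⟩ := h
    rw [Finset.prod_eq_zero (Finset.mem_univ i) (invFact_of_neg (by omega))]
    simp

open PowerSeries in
lemma coeff_expMatrix_mul {k N m t : ℕ} (ht : t ≤ m) (hN : m + k ≤ N) (i j : Fin k) :
    coeff t (((expMatrix k N).transpose * expMatrix k N) i j) =
      coeff t (besselI2 ((i : ℤ) - (j : ℤ)).natAbs) := by
  set ν := ((i : ℤ) - (j : ℤ)).natAbs with hν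
  have hi := i.2
  have hj := j.2
  have hentry : ∀ a : Fin N, coeff t ((expMatrix k N).transpose i a * expMatrix k N a j) =
      if t = ((a : ℕ) - (i : ℕ)) + ((a : ℕ) - (j : ℕ)) then
        invFact ((a : ℕ) - (i : ℕ)) * invFact ((a : ℕ) - (j : ℕ)) else 0 := by
    intro a
    rw [← coeff_C_mul_X_pow]
    congr 1
    simp only [expMatrix, Matrix.transpose_apply, Matrix.of_apply, map_mul]
    ring
  rw [Matrix.mul_apply, map_sum, besselI2, coeff_mk]
  simp only [hentry]
  split_ifs with h
  · obtain ⟨a, ha⟩ : ∃ a : ℕ, 2 * a = t + i + j := ⟨(t + i + j) / 2, by omega⟩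
    have haN : a < N := by omega
    rw [Finset.sum_eq_single ⟨a, haN⟩]
    · have hai : ((a : ℤ) - (i : ℕ)) = ((a - i : ℕ) : ℤ) := by omega
      have haj : ((a : ℤ) - (j : ℕ)) = ((a - j : ℕ) : ℤ) := by omega
      simp only
      rw [if_pos (by omega), hai, haj, invFact_natCast, invFact_natCast, div_mul_div_comm, one_mul]
      rcases le_total (i : ℕ) j with hij | hij
      · rw [show a - (j : ℕ) = (t - ν) / 2 by omega, show a - (i : ℕ) = (t - ν) / 2 + ν by omega,
          mul_comm ((Nat.factorial _ : ℕ) : ℚ)]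
      · rw [show a - (i : ℕ) = (t - ν) / 2 by omega, show a - (j : ℕ) = (t - ν) / 2 + ν by omega]
    · intro b _ hb
      have hb : (b : ℕ) ≠ a := fun h => hb (Fin.ext h)
      split_ifs with hbt
      · rcases lt_or_ge (b : ℕ) i with h1 | h1
        · rw [invFact_of_neg (m := (b : ℕ) - (i : ℕ)) (by omega), zero_mul]
        · rw [invFact_of_neg (m := (b : ℕ) - (j : ℕ)) (by omega), mul_zero]
      · rfl
    · simp
  · refine Finset.sum_eq_zero fun b _ => ?_
    split_ifs with hbt
    · rcases lt_or_ge (b : ℕ) i with h1 | h1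
      · rw [invFact_of_neg (m := (b : ℕ) - (i : ℕ)) (by omega), zero_mul]
      · rw [invFact_of_neg (m := (b : ℕ) - (j : ℕ)) (by omega), mul_zero]
    · rfl

open PowerSeries in
lemma coeff_det_eq {R : Type*} [CommRing R] {ι : Type*} [Fintype ι] [DecidableEq ι] {m : ℕ}
    {A B : Matrix ι ι R⟦X⟧} (h : ∀ t ≤ m, ∀ i j, coeff t (A i j) = coeff t (B i j)) :
    coeff m A.det = coeff m B.det := by
  let q := Ideal.Quotient.mk (Ideal.span {(X : R⟦X⟧) ^ (m + 1)})
  have hq : ∀ φ ψ : R⟦X⟧, q φ = q ψ ↔ ∀ t ≤ m, coeff t φ = coeff t ψ := by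
    intro φ ψ
    rw [Ideal.Quotient.eq, Ideal.mem_span_singleton, X_pow_dvd_iff]
    simp only [map_sub, sub_eq_zero, Nat.lt_succ_iff]
  have hdet : q A.det = q B.det := by
    rw [RingHom.map_det, RingHom.map_det]
    congr 1
    ext i j
    exact (hq _ _).2 fun t ht => h t ht i j
  exact (hq _ _).1 hdet m le_rfl

lemma sq_card_chains_eq {k n N : ℕ} (e : Fin k ↪o Fin N) :
    ((chains k n (Finset.univ.image fun i => (e i : ℕ))).card : ℚ) ^ 2 / (n.factorial : ℚ) ^ 2 =
      if 2 * n = 2 * (∑ i, (e i : ℕ) - ∑ j : Fin k, (j : ℕ)) then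
        (minor fun i => ((e i : ℕ) : ℤ)) ^ 2 else 0 := by
  have he : StrictMono fun i => (e i : ℕ) := fun i j hij => e.strictMono hij
  have hle : ∑ j : Fin k, (j : ℕ) ≤ ∑ i, (e i : ℕ) :=
    Finset.sum_le_sum fun i _ => val_le_of_strictMono he i
  split_ifs with h
  · rw [card_chains_eq he (by omega), mul_pow]
    have : (n.factorial : ℚ) ≠ 0 := by positivity
    field_simp
  · rw [Finset.card_eq_zero.2, Nat.cast_zero]
    · simp
    · refine Finset.eq_empty_of_forall_notMem fun c hc => h ?_
      have := sum_eq_of_mem_chains hc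
      rw [Finset.sum_image he.injective.injOn] at this
      omega

end Gessel

/-- Gessel's theorem: for every `k ≥ 1`,
`Σ_{n ≥ 0} (u_k(n)/(n!)²) x^{2n} = det (I_{|i-j|}(2x))_{i,j=1,...,k}`
as formal power series over `ℚ`. The left-hand side is the power series whose
coefficient of `x^m` is `u_k(m/2)/((m/2)!)²` for even `m` and `0` for odd `m`. -/
theorem gessel_determinant (k : ℕ) (hk : 1 ≤ k) :
    (PowerSeries.mk fun m =>
        if m % 2 = 0 then (u k (m / 2) : ℚ) / ((m / 2).factorial : ℚ) ^ 2 else 0) =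
      Matrix.det
        (Matrix.of fun i j : Fin k => besselI2 (((i : ℤ) - (j : ℤ)).natAbs)) := by
  ext m
  have hdet := Gessel.coeff_det_eq
    (A := (Gessel.expMatrix k (m + k)).transpose * Gessel.expMatrix k (m + k))
    (B := Matrix.of fun i j : Fin k => besselI2 (((i : ℤ) - (j : ℤ)).natAbs))
    fun t ht i j => Gessel.coeff_expMatrix_mul ht le_rfl i j
  rw [← hdet, Gessel.det_mul_eq_sum_orderEmbedding, map_sum, PowerSeries.coeff_mk]
  have hterm : ∀ e : Fin k ↪o Fin (m + k), PowerSeries.coeff m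
      (((Gessel.expMatrix k (m + k)).transpose.submatrix id e).det *
        ((Gessel.expMatrix k (m + k)).submatrix e id).det) =
      if m = 2 * (∑ i, (e i : ℕ) - ∑ j : Fin k, (j : ℕ)) then
        (Gessel.minor fun i => ((e i : ℕ) : ℤ)) ^ 2 else 0 := by
    intro e
    rw [← Matrix.transpose_submatrix, Matrix.det_transpose, Gessel.det_submatrix_expMatrix,
      ← PowerSeries.coeff_C_mul_X_pow]
    congr 1
    rw [map_pow]
    ring
  simp only [hterm]
  split_ifs with hm
  · obtain ⟨n, rfl⟩ : ∃ n, m = 2 * n := ⟨m / 2, by omega⟩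
    rw [Nat.mul_div_cancel_left n two_pos, Gessel.u_eq_sum_sq (N := 2 * n + k) (by omega),
      Gessel.sum_powersetCard_eq, Nat.cast_sum, Finset.sum_div]
    refine Finset.sum_congr rfl fun e _ => ?_
    rw [← Gessel.sq_card_chains_eq, Nat.cast_pow]
  · exact (Finset.sum_eq_zero fun e _ => if_neg (by omega)).symm
end
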